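/- For every integer k ≥ 2 and every g ∈ H̃⁰_Γ(k), the inner product satisfies (g, Θ_C^{(k)}) = ∫_C g(z)·K(z,z)^{−k/2}·((A_γ^{−1})*φ)(z). -/

import Mathlib

open scoped BigOperators
open Complex MeasureTheory Filter Topology Matrix

namespace BallPaper

noncomputable section

variable {n : ℕ}

/-- The unit ball in ℂⁿ. -/
def ball (n : ℕ) : Set (Fin n → ℂ) := {z | ∑ i, ‖z i‖ ^ 2 < 1}

/-- ⟨z,w⟩ = z₁ conj w₁ + ... + zₙ conj wₙ − 1. -/
def pair (z w : Fin n → ℂ) : ℂ := ∑ i, z i * star (w i) - 1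

/-- The Hermitian form of signature (n,1) on ℂ^{n+1}:
⟨⟨u,v⟩⟩ = u₁ conj v₁ + ... + uₙ conj vₙ − u_{n+1} conj v_{n+1}. -/
def herm (u v : Fin (n + 1) → ℂ) : ℂ :=
  ∑ i : Fin n, u i.castSucc * star (v i.castSucc) - u (Fin.last n) * star (v (Fin.last n))

/-- SU(n,1): determinant-one matrices preserving the (n,1) Hermitian form. -/
def SU (n : ℕ) : Set (Matrix (Fin (n + 1)) (Fin (n + 1)) ℂ) :=
  {A | A.det = 1 ∧ ∀ u v, herm (A.mulVec u) (A.mulVec v) = herm u v}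

/-- The denominator a_{n+1,1} z₁ + ... + a_{n+1,n} zₙ + a_{n+1,n+1} of the
fractional-linear action. -/
def denom (A : Matrix (Fin (n + 1)) (Fin (n + 1)) ℂ) (z : Fin n → ℂ) : ℂ :=
  ∑ j : Fin n, A (Fin.last n) j.castSucc * z j + A (Fin.last n) (Fin.last n)

/-- The fractional-linear action of a matrix on ℂⁿ (defined on the ball). -/
def act (A : Matrix (Fin (n + 1)) (Fin (n + 1)) ℂ) (z : Fin n → ℂ) : Fin n → ℂ :=
  fun j => (∑ l : Fin n, A j.castSucc l.castSucc * z l + A j.castSucc (Fin.last n)) / denom A z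

/-- The complex Jacobian J(A,z) = (denominator)^{-(n+1)}. -/
def jac (A : Matrix (Fin (n + 1)) (Fin (n + 1)) ℂ) (z : Fin n → ℂ) : ℂ :=
  (denom A z)⁻¹ ^ (n + 1)

/-- The Bergman kernel K(z,w) = (n!/πⁿ) (−⟨z,w⟩)^{−(n+1)}. -/
def Kc (z w : Fin n → ℂ) : ℂ :=
  (((Nat.factorial n : ℝ) / Real.pi ^ n : ℝ) : ℂ) * (-(pair z w))⁻¹ ^ (n + 1)

/-- K(z,z) as a real-valued function: K(z,z) = (n!/πⁿ) (1−|z|²)^{−(n+1)}. -/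
def Kr (z : Fin n → ℂ) : ℝ :=
  (Nat.factorial n : ℝ) / Real.pi ^ n * ((1 - ∑ i, ‖z i‖ ^ 2)⁻¹) ^ (n + 1)

/-- c(𝔹ⁿ,k) = C((n+1)(k−1)+n, n). -/
def cB (n k : ℕ) : ℕ := Nat.choose ((n + 1) * (k - 1) + n) n

/-- The last index of Fin n. -/
def lastI (n : ℕ) (hn : 0 < n) : Fin n := ⟨n - 1, by omega⟩

/-- The geodesic C̃₀ = {z ∈ 𝔹ⁿ : z₁ = ... = z_{n−1} = 0, zₙ ∈ (−1,1) real}. -/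
def geo0 (n : ℕ) (hn : 0 < n) : Set (Fin n → ℂ) :=
  {z | (∀ i : Fin n, (i : ℕ) < n - 1 → z i = 0) ∧ (z (lastI n hn)).im = 0 ∧
    -1 < (z (lastI n hn)).re ∧ (z (lastI n hn)).re < 1}

/-- The point (0,...,0,x) of C̃₀. -/
def curve (n : ℕ) (hn : 0 < n) (x : ℝ) : Fin n → ℂ :=
  fun i => if i = lastI n hn then (x : ℂ) else 0

/-- The vector (X,1) ∈ ℂ^{n+1}. -/
def snoc1 (X : Fin n → ℂ) : Fin (n + 1) → ℂ := Fin.snoc X 1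

/-- The matrix A_γ, with columns v₁,...,v_{n−1},
⟨X,Y⟩⁻¹(X,1) + (1/2)(Y,1), ⟨X,Y⟩⁻¹(X,1) − (1/2)(Y,1). -/
def Amat (n : ℕ) (v : Fin (n - 1) → Fin (n + 1) → ℂ) (X Y : Fin n → ℂ) :
    Matrix (Fin (n + 1)) (Fin (n + 1)) ℂ :=
  Matrix.of fun i j =>
    if h : (j : ℕ) < n - 1 then v ⟨j, h⟩ i
    else if (j : ℕ) = n - 1 then ((pair X Y)⁻¹ • snoc1 X + (2 : ℂ)⁻¹ • snoc1 Y) i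
    else ((pair X Y)⁻¹ • snoc1 X - (2 : ℂ)⁻¹ • snoc1 Y) i

/-- σ = diag(1,...,1,−1). -/
def sigmaM (n : ℕ) : Matrix (Fin (n + 1)) (Fin (n + 1)) ℂ :=
  Matrix.diagonal fun i => if i = Fin.last n then -1 else 1

/-- Inverse hyperbolic cosine. -/
def arcosh (x : ℝ) : ℝ := Real.log (x + Real.sqrt (x ^ 2 - 1))

/-- Inverse hyperbolic tangent. -/
def artanh (x : ℝ) : ℝ := Real.log ((1 + x) / (1 - x)) / 2

/-- The hyperbolic (Bergman) distance on the ball, determined by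
cosh²(ρ(z,w)/2) = ⟨z,w⟩⟨w,z⟩/(⟨z,z⟩⟨w,w⟩). -/
def rho (z w : Fin n → ℂ) : ℝ :=
  2 * arcosh (Real.sqrt ((pair z w * pair w z).re / (pair z z * pair w w).re))

/-- A discrete subgroup Γ of SU(n,1) acting freely on the ball with compact quotient. -/
structure DiscreteGroup (n : ℕ) where
  Γ : Set (Matrix (Fin (n + 1)) (Fin (n + 1)) ℂ)
  sub_SU : Γ ⊆ SU n
  one_mem : 1 ∈ Γ
  mul_mem : ∀ {A B}, A ∈ Γ → B ∈ Γ → A * B ∈ Γ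
  inv_mem : ∀ {A}, A ∈ Γ → A⁻¹ ∈ Γ
  discrete : DiscreteTopology ↥Γ
  free : ∀ A ∈ Γ, (∃ z ∈ ball n, act A z = z) → A = 1
  cocompact : ∃ F : Set (Fin n → ℂ), F ⊆ ball n ∧ IsCompact F ∧
    ∀ z ∈ ball n, ∃ A ∈ Γ, act A z ∈ F

/-- A hyperbolic element γ of Γ, with real eigenvalues, real fixed points X, Y on the
boundary, eigenvalue data λ, and the eigenvectors v₁,...,v_{n−1} for eigenvalues ±1,
orthonormal with respect to the form ⟨⟨.,.⟩⟩. -/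
structure HypElt (n : ℕ) (G : DiscreteGroup n) where
  γ : Matrix (Fin (n + 1)) (Fin (n + 1)) ℂ
  mem : γ ∈ G.Γ
  ne_one : γ ≠ 1
  eig_real : ∀ μ ∈ spectrum ℂ γ, μ.im = 0
  X : Fin n → ℂ
  Y : Fin n → ℂ
  X_bd : ∑ i, ‖X i‖ ^ 2 = 1
  Y_bd : ∑ i, ‖Y i‖ ^ 2 = 1
  X_real : ∀ i, (X i).im = 0
  Y_real : ∀ i, (Y i).im = 0
  lam : ℝ
  lam_sq : 1 < lam ^ 2
  eigX : γ.mulVec (snoc1 X) = (lam : ℂ) • snoc1 X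
  eigY : γ.mulVec (snoc1 Y) = ((lam : ℂ))⁻¹ • snoc1 Y
  primitive : ∀ A ∈ G.Γ, ∀ m : ℕ, 2 ≤ m → A ^ m ≠ γ
  v : Fin (n - 1) → Fin (n + 1) → ℂ
  alph : Fin (n - 1) → ℂ
  alph_pm : ∀ j, alph j = 1 ∨ alph j = -1
  v_eig : ∀ j, γ.mulVec (v j) = alph j • v j
  v_on : ∀ j l, herm (v j) (v l) = if j = l then 1 else 0

variable {G : DiscreteGroup n}

/-- The matrix A_γ associated to the hyperbolic element γ. -/
def HypElt.A (H : HypElt n G) : Matrix (Fin (n + 1)) (Fin (n + 1)) ℂ :=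
  Amat n H.v H.X H.Y

/-- γ₀ = A_γ⁻¹ γ A_γ. -/
def HypElt.g0 (H : HypElt n G) : Matrix (Fin (n + 1)) (Fin (n + 1)) ℂ :=
  (H.A)⁻¹ * H.γ * H.A

/-- T = (λ²−1)/(λ²+1), the last coordinate of γ₀(0). -/
def HypElt.T (H : HypElt n G) : ℝ := (H.lam ^ 2 - 1) / (H.lam ^ 2 + 1)

/-- The geodesic C̃ in 𝔹ⁿ with endpoints X, Y, as the image of C̃₀ under A_γ. -/
def HypElt.Ct (H : HypElt n G) (hn : 0 < n) : Set (Fin n → ℂ) :=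
  act H.A '' geo0 n hn

/-- The length l(C) of the closed geodesic C, the hyperbolic distance from 0 to γ₀(0). -/
def HypElt.lenC (H : HypElt n G) : ℝ :=
  rho (0 : Fin n → ℂ) (act H.g0 (0 : Fin n → ℂ))

/-- A (measure-theoretic) fundamental domain for the action of Γ on the ball. -/
def IsFundDom (G : DiscreteGroup n) (F : Set (Fin n → ℂ)) : Prop :=
  F ⊆ ball n ∧ MeasurableSet F ∧ (∀ z ∈ ball n, ∃ A ∈ G.Γ, act A z ∈ F) ∧
    ∀ A ∈ G.Γ, A ≠ 1 → volume {z ∈ F | act A z ∈ F} = 0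

/-- The automorphy condition f(Az) J(A,z)^k = f(z). -/
def Automorphic (G : DiscreteGroup n) (k : ℕ) (f : (Fin n → ℂ) → ℂ) : Prop :=
  ∀ A ∈ G.Γ, ∀ z ∈ ball n, f (act A z) * jac A z ^ k = f z

/-- Membership in H̃⁰_Γ(k): holomorphic on the ball and automorphic of weight k. -/
def Htilde (G : DiscreteGroup n) (k : ℕ) (f : (Fin n → ℂ) → ℂ) : Prop :=
  DifferentiableOn ℂ f (ball n) ∧ Automorphic G k f

/-- The inner product (f,g) = ∫_M f ḡ K(z,z)^{−k} dV = ∫_F f ḡ K(z,z)^{1−k} dV_e,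
computed over a fundamental domain F. -/
def iprod (F : Set (Fin n → ℂ)) (k : ℕ) (f g : (Fin n → ℂ) → ℂ) : ℂ :=
  ∫ z in F, f z * star (g z) * ((Kr z ^ ((1 : ℤ) - (k : ℤ)) : ℝ) : ℂ)

/-- The Poincaré series Θ_w^{(k)}(z) = c(𝔹ⁿ,k) Σ_{A∈Γ} K(Az,w)^k J(A,z)^k. -/
def ThetaPt (G : DiscreteGroup n) (k : ℕ) (w z : Fin n → ℂ) : ℂ :=
  (cB n k : ℂ) * ∑' A : ↥G.Γ, Kc (act (A : Matrix (Fin (n + 1)) (Fin (n + 1)) ℂ) z) w ^ k *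
    jac (A : Matrix (Fin (n + 1)) (Fin (n + 1)) ℂ) z ^ k

/-- The relative Poincaré series
Θ_C^{(k)}(z) = ∫_C Θ_w^{(k)}(z) K(w,w)^{−k/2} ((A_γ⁻¹)*φ)(w), written out over one
period of C̃, parametrized by w = A_γ(0,...,0,x), x ∈ [0,T]. -/
def ThetaC (hn : 0 < n) (H : HypElt n G) (k : ℕ) (z : Fin n → ℂ) : ℂ :=
  ∫ x in (0 : ℝ)..H.T, ThetaPt G k (act H.A (curve n hn x)) z *
    ((Kr (act H.A (curve n hn x)) ^ (-(k : ℝ) / 2) : ℝ) : ℂ) *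
    ((Kr (curve n hn x) ^ (((n : ℝ) + 1))⁻¹ : ℝ) : ℂ)

/-- The set of integer powers of a matrix. -/
def zpows (g : Matrix (Fin (n + 1)) (Fin (n + 1)) ℂ) :
    Set (Matrix (Fin (n + 1)) (Fin (n + 1)) ℂ) := {h | ∃ m : ℤ, h = g ^ m}

/-- The conjugate group A_γ⁻¹ Γ A_γ. -/
def conjGrp (G : DiscreteGroup n) (H : HypElt n G) :
    Set (Matrix (Fin (n + 1)) (Fin (n + 1)) ℂ) :=
  (fun g => (H.A)⁻¹ * g * H.A) '' G.Γ

end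

end BallPaper

namespace BallPaper

section Unitary

variable {n : ℕ}

/-- Matrices preserving the Hermitian form, with determinant of modulus one. -/
def IsUnitaryForm (A : Matrix (Fin (n + 1)) (Fin (n + 1)) ℂ) : Prop :=
  ‖A.det‖ = 1 ∧ ∀ u v, herm (A.mulVec u) (A.mulVec v) = herm u v

lemma IsUnitaryForm.of_mem_SU {A : Matrix (Fin (n + 1)) (Fin (n + 1)) ℂ} (hA : A ∈ SU n) :
    IsUnitaryForm A := ⟨by rw [hA.1]; simp, hA.2⟩

lemma IsUnitaryForm.isUnit_det {A : Matrix (Fin (n + 1)) (Fin (n + 1)) ℂ}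
    (hA : IsUnitaryForm A) : IsUnit A.det := by
  rw [isUnit_iff_ne_zero]
  intro h
  simpa [h] using hA.1

lemma IsUnitaryForm.inv {A : Matrix (Fin (n + 1)) (Fin (n + 1)) ℂ} (hA : IsUnitaryForm A) :
    IsUnitaryForm A⁻¹ := by
  refine ⟨?_, fun u v => ?_⟩
  · rw [Matrix.det_nonsing_inv, Ring.inverse_eq_inv', norm_inv, hA.1, inv_one]
  · rw [← hA.2 (A⁻¹ *ᵥ u), Matrix.mulVec_mulVec, Matrix.mulVec_mulVec,
      Matrix.mul_nonsing_inv _ hA.isUnit_det, Matrix.one_mulVec, Matrix.one_mulVec]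

@[simp] lemma snoc1_castSucc (z : Fin n → ℂ) (i : Fin n) : snoc1 z i.castSucc = z i := by
  simp [snoc1]

@[simp] lemma snoc1_last (z : Fin n → ℂ) : snoc1 z (Fin.last n) = 1 := by
  simp [snoc1]

lemma herm_snoc1 (z w : Fin n → ℂ) : herm (snoc1 z) (snoc1 w) = pair z w := by
  simp [herm, pair]

lemma herm_smul_smul (a b : ℂ) (u v : Fin (n + 1) → ℂ) :
    herm (a • u) (b • v) = a * star b * herm u v := by
  simp only [herm, Pi.smul_apply, smul_eq_mul, star_mul', mul_sub, Finset.mul_sum]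
  congr 1
  · exact Finset.sum_congr rfl fun i _ => by ring
  · ring

lemma mul_star_eq_normSq (a : ℂ) : a * star a = ((‖a‖ ^ 2 : ℝ) : ℂ) := by
  rw [← starRingEnd_apply, Complex.mul_conj, Complex.normSq_eq_norm_sq]

lemma pair_self (z : Fin n → ℂ) : pair z z = ((∑ i, ‖z i‖ ^ 2 - 1 : ℝ) : ℂ) := by
  simp only [pair, mul_star_eq_normSq]
  push_cast
  rfl

lemma star_pair (z w : Fin n → ℂ) : star (pair z w) = pair w z := by
  simp [pair, star_sum, mul_comm]

lemma mulVec_snoc1_last (A : Matrix (Fin (n + 1)) (Fin (n + 1)) ℂ) (z : Fin n → ℂ) :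
    (A *ᵥ snoc1 z) (Fin.last n) = denom A z := by
  simp [Matrix.mulVec, dotProduct, Fin.sum_univ_castSucc, denom]

lemma act_apply (A : Matrix (Fin (n + 1)) (Fin (n + 1)) ℂ) (z : Fin n → ℂ) (j : Fin n) :
    act A z j = (A *ᵥ snoc1 z) j.castSucc / denom A z := by
  simp [Matrix.mulVec, dotProduct, Fin.sum_univ_castSucc, act]

lemma mulVec_snoc1 {A : Matrix (Fin (n + 1)) (Fin (n + 1)) ℂ} {z : Fin n → ℂ}
    (h : denom A z ≠ 0) : A *ᵥ snoc1 z = denom A z • snoc1 (act A z) := by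
  ext i
  refine Fin.lastCases ?_ (fun j => ?_) i
  · simp [mulVec_snoc1_last]
  · simp [act_apply, mul_div_cancel₀ _ h]

lemma IsUnitaryForm.denom_ne_zero {A : Matrix (Fin (n + 1)) (Fin (n + 1)) ℂ}
    (hA : IsUnitaryForm A) {z : Fin n → ℂ} (hz : z ∈ ball n) : denom A z ≠ 0 := by
  intro h
  have h1 := hA.2 (snoc1 z) (snoc1 z)
  rw [herm_snoc1, pair_self, herm, mulVec_snoc1_last, h, zero_mul, sub_zero] at h1
  simp only [mul_star_eq_normSq] at h1
  rw [← Complex.ofReal_sum, Complex.ofReal_inj] at h1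
  have h2 : 0 ≤ ∑ i : Fin n, ‖(A *ᵥ snoc1 z) i.castSucc‖ ^ 2 := by positivity
  have h3 : ∑ i, ‖z i‖ ^ 2 < 1 := hz
  linarith

lemma IsUnitaryForm.pair_act {A : Matrix (Fin (n + 1)) (Fin (n + 1)) ℂ}
    (hA : IsUnitaryForm A) {z w : Fin n → ℂ} (hz : z ∈ ball n) (hw : w ∈ ball n) :
    pair z w = denom A z * star (denom A w) * pair (act A z) (act A w) := by
  rw [← herm_snoc1 z w, ← hA.2, mulVec_snoc1 (hA.denom_ne_zero hz),
    mulVec_snoc1 (hA.denom_ne_zero hw), herm_smul_smul, herm_snoc1]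

lemma IsUnitaryForm.one_sub_act {A : Matrix (Fin (n + 1)) (Fin (n + 1)) ℂ}
    (hA : IsUnitaryForm A) {z : Fin n → ℂ} (hz : z ∈ ball n) :
    1 - ∑ i, ‖z i‖ ^ 2 = ‖denom A z‖ ^ 2 * (1 - ∑ i, ‖act A z i‖ ^ 2) := by
  have h := hA.pair_act hz hz
  rw [mul_star_eq_normSq, pair_self, pair_self, ← Complex.ofReal_mul, Complex.ofReal_inj] at h
  linarith

lemma IsUnitaryForm.act_mem {A : Matrix (Fin (n + 1)) (Fin (n + 1)) ℂ}
    (hA : IsUnitaryForm A) {z : Fin n → ℂ} (hz : z ∈ ball n) : act A z ∈ ball n := by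
  have h := hA.one_sub_act hz
  have h1 : 0 < ‖denom A z‖ ^ 2 := by
    have := norm_pos_iff.2 (hA.denom_ne_zero hz)
    positivity
  have h3 : ∑ i, ‖z i‖ ^ 2 < 1 := hz
  rw [ball, Set.mem_ofPred_eq]
  have h4 : 0 < ‖denom A z‖ ^ 2 * (1 - ∑ i, ‖act A z i‖ ^ 2) := by linarith
  linarith [(mul_pos_iff_of_pos_left h1).1 h4]

lemma act_mul {A B : Matrix (Fin (n + 1)) (Fin (n + 1)) ℂ} {z : Fin n → ℂ}
    (h : denom B z ≠ 0) : act (A * B) z = act A (act B z) := by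
  ext j
  rw [act_apply, act_apply, ← mulVec_snoc1_last, ← mulVec_snoc1_last, ← Matrix.mulVec_mulVec,
    mulVec_snoc1 h, Matrix.mulVec_smul, Pi.smul_apply, Pi.smul_apply, smul_eq_mul, smul_eq_mul,
    mul_div_mul_left _ _ h]

lemma act_one (z : Fin n → ℂ) : act 1 z = z := by
  ext j
  rw [act_apply, ← mulVec_snoc1_last]
  simp

lemma IsUnitaryForm.act_inv_act {A : Matrix (Fin (n + 1)) (Fin (n + 1)) ℂ}
    (hA : IsUnitaryForm A) {z : Fin n → ℂ} (hz : z ∈ ball n) : act A⁻¹ (act A z) = z := by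
  rw [← act_mul (hA.denom_ne_zero hz), Matrix.nonsing_inv_mul _ hA.isUnit_det, act_one]

lemma IsUnitaryForm.act_act_inv {A : Matrix (Fin (n + 1)) (Fin (n + 1)) ℂ}
    (hA : IsUnitaryForm A) {z : Fin n → ℂ} (hz : z ∈ ball n) : act A (act A⁻¹ z) = z := by
  rw [← act_mul (hA.inv.denom_ne_zero hz), Matrix.mul_nonsing_inv _ hA.isUnit_det, act_one]

lemma IsUnitaryForm.injOn {A : Matrix (Fin (n + 1)) (Fin (n + 1)) ℂ} (hA : IsUnitaryForm A) :
    Set.InjOn (act A) (ball n) := fun z hz w hw h => by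
  rw [← hA.act_inv_act hz, h, hA.act_inv_act hw]

lemma IsUnitaryForm.image_ball {A : Matrix (Fin (n + 1)) (Fin (n + 1)) ℂ}
    (hA : IsUnitaryForm A) : act A '' ball n = ball n := by
  apply Set.Subset.antisymm
  · rintro _ ⟨z, hz, rfl⟩
    exact hA.act_mem hz
  · exact fun z hz => ⟨act A⁻¹ z, hA.inv.act_mem hz, hA.act_act_inv hz⟩

/-- The matrix of the complex derivative of the fractional-linear map `act A` at `z`. -/
noncomputable def actDeriv (A : Matrix (Fin (n + 1)) (Fin (n + 1)) ℂ) (z : Fin n → ℂ) :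
    Matrix (Fin n) (Fin n) ℂ :=
  (denom A z)⁻¹ • Matrix.of fun i j =>
    A i.castSucc j.castSucc - act A z i * A (Fin.last n) j.castSucc

lemma hasFDerivAt_act {A : Matrix (Fin (n + 1)) (Fin (n + 1)) ℂ} {z : Fin n → ℂ}
    (h : denom A z ≠ 0) :
    HasFDerivAt (act A) (LinearMap.toContinuousLinearMap (Matrix.toLin' (actDeriv A z))) z := by
  have hlin (i : Fin (n + 1)) (b : ℂ) :
      HasFDerivAt (fun z : Fin n → ℂ => ∑ l : Fin n, A i l.castSucc * z l + b)
      (∑ l : Fin n, A i l.castSucc • ContinuousLinearMap.proj (R := ℂ) (φ := fun _ : Fin n => ℂ) l)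
        z := by
    refine HasFDerivAt.add_const _ (HasFDerivAt.fun_sum fun l _ => ?_)
    exact (hasFDerivAt_apply l z).const_mul _
  rw [hasFDerivAt_pi']
  intro i
  have := (hlin i.castSucc (A i.castSucc (Fin.last n))).fun_mul
    ((hasDerivAt_inv h).comp_hasFDerivAt z (hlin (Fin.last n) (A (Fin.last n) (Fin.last n))))
  refine this.congr_fderiv ?_
  ext v
  have h' : ∑ j : Fin n, A (Fin.last n) j.castSucc * z j + A (Fin.last n) (Fin.last n) ≠ 0 := h
  simp only [actDeriv, act, denom, Matrix.toLin'_apply, Matrix.mulVec, dotProduct,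
    ContinuousLinearMap.coe_comp, Function.comp, LinearMap.coe_toContinuousLinearMap',
    ContinuousLinearMap.proj_apply, _root_.smul_apply, _root_.add_apply,
    _root_.sum_apply, Matrix.smul_apply, Matrix.of_apply, smul_eq_mul, sub_mul,
    mul_sub, Finset.sum_sub_distrib]
  rw [add_comm, sub_eq_add_neg, ← Finset.sum_neg_distrib, Finset.mul_sum, Finset.mul_sum,
    Finset.mul_sum]
  congr 1
  · exact Finset.sum_congr rfl fun j _ => by ring
  · exact Finset.sum_congr rfl fun j _ => by field_simp

lemma det_actDeriv {A : Matrix (Fin (n + 1)) (Fin (n + 1)) ℂ} {z : Fin n → ℂ}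
    (h : denom A z ≠ 0) : (actDeriv A z).det = A.det * jac A z := by
  set e : Fin n ⊕ Fin 1 ≃ Fin (n + 1) := finSumFinEquiv
  have hl (i : Fin n) : e (Sum.inl i) = i.castSucc := rfl
  have hr (i : Fin 1) : e (Sum.inr i) = Fin.last n := by
    fin_cases i; rfl
  set M : Matrix (Fin n) (Fin n) ℂ := Matrix.of fun i j =>
    A i.castSucc j.castSucc - act A z i * A (Fin.last n) j.castSucc with hM
  set c : Matrix (Fin 1) (Fin n) ℂ := Matrix.of fun _ j => A (Fin.last n) j.castSucc
  set d : Matrix (Fin 1) (Fin 1) ℂ := Matrix.of fun _ _ => denom A z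
  set L : Matrix (Fin n ⊕ Fin 1) (Fin n ⊕ Fin 1) ℂ :=
    Matrix.fromBlocks 1 (Matrix.of fun i _ => - act A z i) 0 1
  set R : Matrix (Fin n ⊕ Fin 1) (Fin n ⊕ Fin 1) ℂ :=
    Matrix.fromBlocks 1 (Matrix.of fun i _ => z i) 0 1
  have key : L * A.submatrix e e * R = Matrix.fromBlocks M 0 c d := by
    have hA : A.submatrix e e = Matrix.fromBlocks (Matrix.of fun i j => A i.castSucc j.castSucc)
        (Matrix.of fun i _ => A i.castSucc (Fin.last n)) c
        (Matrix.of fun _ _ => A (Fin.last n) (Fin.last n)) := by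
      ext (i | i) (j | j) <;> simp [hl, hr, c]
    rw [hA, Matrix.fromBlocks_multiply, Matrix.fromBlocks_multiply]
    congr 1
    · ext i j
      simp [M, Matrix.mul_apply, c]
      ring
    · ext i j
      have hact : act A z i * denom A z =
        ∑ l : Fin n, A i.castSucc l.castSucc * z l + A i.castSucc (Fin.last n) :=
        div_mul_cancel₀ _ h
      have hd : denom A z =
        ∑ j : Fin n, A (Fin.last n) j.castSucc * z j + A (Fin.last n) (Fin.last n) := rfl
      simp only [Matrix.mul_apply, Matrix.add_apply, Matrix.one_mul, Matrix.mul_one, c,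
        Matrix.of_apply, Matrix.zero_apply, Finset.univ_unique, Finset.sum_singleton, add_mul,
        Finset.sum_add_distrib, neg_mul, Finset.sum_neg_distrib]
      have : ∑ x, act A z i * A (Fin.last n) x.castSucc * z x =
          act A z i * ∑ x : Fin n, A (Fin.last n) x.castSucc * z x := by
        rw [Finset.mul_sum]
        exact Finset.sum_congr rfl fun _ _ => by ring
      rw [this]
      linear_combination -hact + act A z i * hd
    · ext i j
      simp [c]
    · ext i j
      simp [Matrix.mul_apply, c, d, denom]
  have h2 := congrArg Matrix.det key
  rw [Matrix.det_mul, Matrix.det_mul, Matrix.det_fromBlocks_zero₂₁, Matrix.det_fromBlocks_zero₂₁,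
    Matrix.det_fromBlocks_zero₁₂, Matrix.det_submatrix_equiv_self] at h2
  rw [Matrix.det_one, Matrix.det_one, one_mul, one_mul, mul_one,
    show d.det = denom A z by rw [Matrix.det_unique]; rfl] at h2
  rw [actDeriv, ← hM, Matrix.det_smul, h2, jac, pow_succ, Fintype.card_fin]
  field_simp

lemma IsUnitaryForm.hasFDerivWithinAt {A : Matrix (Fin (n + 1)) (Fin (n + 1)) ℂ}
    (hA : IsUnitaryForm A) {s : Set (Fin n → ℂ)} {z : Fin n → ℂ} (hz : z ∈ ball n) :
    HasFDerivWithinAt (act A) ((LinearMap.toContinuousLinearMap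
      (Matrix.toLin' (actDeriv A z))).restrictScalars ℝ) s z :=
  ((hasFDerivAt_act (hA.denom_ne_zero hz)).restrictScalars ℝ).hasFDerivWithinAt

lemma IsUnitaryForm.abs_det {A : Matrix (Fin (n + 1)) (Fin (n + 1)) ℂ}
    (hA : IsUnitaryForm A) {z : Fin n → ℂ} (hz : z ∈ ball n) :
    |((LinearMap.toContinuousLinearMap
      (Matrix.toLin' (actDeriv A z))).restrictScalars ℝ).det| = ‖jac A z‖ ^ 2 := by
  have h : ((LinearMap.toContinuousLinearMap
      (Matrix.toLin' (actDeriv A z))).restrictScalars ℝ).det =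
      LinearMap.det ((Matrix.toLin' (actDeriv A z)).restrictScalars ℝ) := rfl
  rw [h, LinearMap.det_restrictScalars, LinearMap.det_toLin', Algebra.norm_complex_apply,
    det_actDeriv (hA.denom_ne_zero hz), Complex.normSq_eq_norm_sq, norm_mul, hA.1, one_mul,
    abs_of_nonneg (by positivity)]

end Unitary

section Volume

variable {n : ℕ}

lemma isOpen_ball : IsOpen (ball n) :=
  isOpen_lt (by fun_prop) continuous_const

lemma measurableSet_ball : MeasurableSet (ball n) := isOpen_ball.measurableSet

open Pointwise in
lemma volume_sum_sq_lt (ι : Type*) [Fintype ι] {r : ℝ} (hr : 0 < r) :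
    volume {x : ι → ℂ | ∑ i, ‖x i‖ ^ 2 < r} =
      ENNReal.ofReal (r ^ Fintype.card ι * (Real.pi ^ Fintype.card ι /
        (Fintype.card ι).factorial)) := by
  have h1 : volume {x : ι → ℂ | ∑ i, ‖x i‖ ^ 2 < 1} =
      ENNReal.ofReal (Real.pi ^ Fintype.card ι / (Fintype.card ι).factorial) := by
    have h := Complex.volume_sum_rpow_lt_one ι (p := 2) (by norm_num)
    norm_num at h
    rw [h, Real.Gamma_nat_eq_factorial]
  have h2 : {x : ι → ℂ | ∑ i, ‖x i‖ ^ 2 < r} =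
      (Real.sqrt r) • {x : ι → ℂ | ∑ i, ‖x i‖ ^ 2 < 1} := by
    have hs : 0 < Real.sqrt r := Real.sqrt_pos.2 hr
    ext x
    rw [Set.mem_smul_set_iff_inv_smul_mem₀ hs.ne', Set.mem_ofPred_eq, Set.mem_ofPred_eq]
    simp only [Pi.smul_apply, norm_smul, mul_pow, ← Finset.mul_sum, norm_inv, inv_pow,
      Real.norm_eq_abs, sq_abs, Real.sq_sqrt hr.le]
    rw [inv_mul_lt_iff₀ hr, mul_one]
  rw [h2, Measure.addHaar_smul, h1, ← ENNReal.ofReal_mul (abs_nonneg _)]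
  congr 2
  rw [Module.finrank_pi_fintype]
  simp only [Complex.finrank_real_complex, Finset.sum_const, Finset.card_univ, smul_eq_mul]
  rw [mul_comm, pow_mul, Real.sq_sqrt hr.le, abs_of_nonneg (by positivity)]

lemma lintegral_ball_pow (n s : ℕ) :
    ∫⁻ z in ball n, ENNReal.ofReal ((1 - ∑ i, ‖z i‖ ^ 2) ^ s) =
      ENNReal.ofReal (Real.pi ^ n * s.factorial / (n + s).factorial) := by
  set S : Set (Fin n ⊕ Fin s → ℂ) := {x | ∑ i, ‖x i‖ ^ 2 < 1} with hS
  have hSo : MeasurableSet S := (isOpen_lt (by fun_prop) continuous_const).measurableSet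
  have hvol := volume_sum_sq_lt (Fin n ⊕ Fin s) one_pos
  have hmp := (volume_measurePreserving_sumPiEquivProdPi_symm (fun _ : Fin n ⊕ Fin s => ℂ))
  have h1 := hmp.measure_preimage hSo.nullMeasurableSet
  rw [Measure.volume_eq_prod, Measure.prod_apply (hmp.measurable hSo), hvol] at h1
  have h2 (z : Fin n → ℂ) : volume (Prod.mk z ⁻¹' ((MeasurableEquiv.sumPiEquivProdPi
      (fun _ : Fin n ⊕ Fin s => ℂ)).symm ⁻¹' S)) = (ball n).indicator (fun z =>
        ENNReal.ofReal ((1 - ∑ i, ‖z i‖ ^ 2) ^ s) *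
          ENNReal.ofReal (Real.pi ^ s / s.factorial)) z := by
    have h3 : (Prod.mk z ⁻¹' ((MeasurableEquiv.sumPiEquivProdPi
      (fun _ : Fin n ⊕ Fin s => ℂ)).symm ⁻¹' S)) =
        {x : Fin s → ℂ | ∑ i, ‖x i‖ ^ 2 < 1 - ∑ i, ‖z i‖ ^ 2} := by
      ext x
      simp only [Set.mem_preimage, hS, Set.mem_ofPred_eq, Fintype.sum_sum_type]
      exact lt_sub_iff_add_lt'.symm
    rw [h3]
    by_cases hz : z ∈ ball n
    · have hz' : ∑ i, ‖z i‖ ^ 2 < 1 := hz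
      rw [Set.indicator_of_mem hz, volume_sum_sq_lt _ (by linarith), Fintype.card_fin,
        ENNReal.ofReal_mul (pow_nonneg (by linarith) _)]
    · have hz' : ¬ ∑ i, ‖z i‖ ^ 2 < 1 := hz
      rw [Set.indicator_of_notMem hz]
      convert measure_empty (μ := (volume : Measure (Fin s → ℂ)))
      ext x
      simp only [Set.mem_ofPred_eq, Set.mem_empty_iff_false, iff_false, not_lt]
      have : 0 ≤ ∑ i, ‖x i‖ ^ 2 := by positivity
      linarith
  simp_rw [h2] at h1
  rw [lintegral_indicator measurableSet_ball, lintegral_mul_const' _ _ (by simp)] at h1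
  have hpos : 0 < Real.pi ^ s / s.factorial := by positivity
  rw [mul_comm] at h1
  rw [(ENNReal.eq_div_iff (by simpa using hpos) (by simp)).2 h1, ← ENNReal.ofReal_div_of_pos hpos]
  congr 1
  simp only [Fintype.card_sum, Fintype.card_fin, one_pow, one_mul, pow_add]
  field_simp

end Volume

section ChangeOfVariables

variable {n : ℕ} {A : Matrix (Fin (n + 1)) (Fin (n + 1)) ℂ}

lemma IsUnitaryForm.continuousOn_act (hA : IsUnitaryForm A) : ContinuousOn (act A) (ball n) :=
  fun _ hz => (hA.hasFDerivWithinAt hz).continuousWithinAt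

lemma IsUnitaryForm.measurableSet_image (hA : IsUnitaryForm A) {s : Set (Fin n → ℂ)}
    (hs : MeasurableSet s) (hsb : s ⊆ ball n) : MeasurableSet (act A '' s) :=
  hs.image_of_continuousOn_injOn (hA.continuousOn_act.mono hsb) (hA.injOn.mono hsb)

lemma IsUnitaryForm.volume_image (hA : IsUnitaryForm A) {s : Set (Fin n → ℂ)}
    (hs : MeasurableSet s) (hsb : s ⊆ ball n) :
    ∫⁻ z in s, ENNReal.ofReal (‖jac A z‖ ^ 2) = volume (act A '' s) := by
  rw [← lintegral_abs_det_fderiv_eq_addHaar_image volume hs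
    (fun z hz => hA.hasFDerivWithinAt (hsb hz)) (hA.injOn.mono hsb)]
  exact setLIntegral_congr_fun hs fun z hz => by rw [hA.abs_det (hsb hz)]

lemma IsUnitaryForm.integrableOn_image_iff {E : Type*} [NormedAddCommGroup E]
    [NormedSpace ℝ E] (hA : IsUnitaryForm A) {s : Set (Fin n → ℂ)}
    (hs : MeasurableSet s) (hsb : s ⊆ ball n) (f : (Fin n → ℂ) → E) :
    IntegrableOn f (act A '' s) ↔ IntegrableOn (fun z => ‖jac A z‖ ^ 2 • f (act A z)) s := by
  rw [integrableOn_image_iff_integrableOn_abs_det_fderiv_smul volume hs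
    (fun z hz => hA.hasFDerivWithinAt (hsb hz)) (hA.injOn.mono hsb)]
  exact integrableOn_congr_fun (fun z hz => by rw [hA.abs_det (hsb hz)]) hs

lemma IsUnitaryForm.integral_image {E : Type*} [NormedAddCommGroup E]
    [NormedSpace ℝ E] (hA : IsUnitaryForm A) {s : Set (Fin n → ℂ)}
    (hs : MeasurableSet s) (hsb : s ⊆ ball n) (f : (Fin n → ℂ) → E) :
    ∫ z in act A '' s, f z = ∫ z in s, ‖jac A z‖ ^ 2 • f (act A z) := by
  rw [integral_image_eq_integral_abs_det_fderiv_smul volume hs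
    (fun z hz => hA.hasFDerivWithinAt (hsb hz)) (hA.injOn.mono hsb)]
  exact setIntegral_congr_fun hs fun z hz => by simp only [hA.abs_det (hsb hz)]

end ChangeOfVariables

section Kernel

variable {n : ℕ} {A : Matrix (Fin (n + 1)) (Fin (n + 1)) ℂ}

lemma one_sub_pos_of_mem_ball {z : Fin n → ℂ} (hz : z ∈ ball n) : 0 < 1 - ∑ i, ‖z i‖ ^ 2 := by
  have : ∑ i, ‖z i‖ ^ 2 < 1 := hz
  linarith

lemma factorial_div_pi_pow_pos (n : ℕ) : 0 < (Nat.factorial n : ℝ) / Real.pi ^ n := by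
  positivity

lemma Kr_pos {z : Fin n → ℂ} (hz : z ∈ ball n) : 0 < Kr z :=
  mul_pos (factorial_div_pi_pow_pos n) (pow_pos (inv_pos.2 (one_sub_pos_of_mem_ball hz)) _)

lemma IsUnitaryForm.jac_ne_zero (hA : IsUnitaryForm A) {z : Fin n → ℂ} (hz : z ∈ ball n) :
    jac A z ≠ 0 :=
  pow_ne_zero _ (inv_ne_zero (hA.denom_ne_zero hz))

lemma IsUnitaryForm.Kc_act (hA : IsUnitaryForm A) {z w : Fin n → ℂ} (hz : z ∈ ball n)
    (hw : w ∈ ball n) : Kc (act A z) (act A w) * jac A z * star (jac A w) = Kc z w := by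
  rw [Kc, Kc, hA.pair_act hz hw, jac, jac, star_pow, star_inv₀, neg_mul_eq_mul_neg, mul_inv,
    mul_inv, mul_pow, mul_pow]
  ring

lemma IsUnitaryForm.Kr_act (hA : IsUnitaryForm A) {z : Fin n → ℂ} (hz : z ∈ ball n) :
    Kr (act A z) * ‖jac A z‖ ^ 2 = Kr z := by
  rw [Kr, Kr, hA.one_sub_act hz, jac, norm_pow, norm_inv, mul_inv, mul_pow]
  ring

lemma Kr_zpow_one_sub {z : Fin n → ℂ} (m : ℕ) :
    Kr z ^ ((1 : ℤ) - ((m + 1 : ℕ) : ℤ)) = (Kr z ^ m)⁻¹ := by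
  rw [show (1 : ℤ) - ((m + 1 : ℕ) : ℤ) = -(m : ℤ) by push_cast; ring, _root_.zpow_neg, zpow_natCast]

lemma Kr_pow_inv (z : Fin n → ℂ) (m : ℕ) :
    (Kr z ^ m)⁻¹ = ((Nat.factorial n : ℝ) / Real.pi ^ n)⁻¹ ^ m *
      (1 - ∑ i, ‖z i‖ ^ 2) ^ ((n + 1) * m) := by
  rw [Kr, mul_pow, mul_inv, ← pow_mul, ← inv_pow, ← inv_pow (1 - _)⁻¹, inv_inv]

lemma continuousOn_Kr : ContinuousOn (Kr (n := n)) (ball n) := by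
  unfold Kr
  refine continuousOn_const.mul (ContinuousOn.pow (ContinuousOn.inv₀ (by fun_prop) ?_) _)
  exact fun z hz => (one_sub_pos_of_mem_ball hz).ne'

lemma differentiable_denom : Differentiable ℂ (denom A) := by
  unfold denom
  fun_prop

lemma IsUnitaryForm.differentiableOn_jac (hA : IsUnitaryForm A) :
    DifferentiableOn ℂ (jac A) (ball n) :=
  (DifferentiableOn.inv (differentiable_denom.differentiableOn)
    fun _ hz => hA.denom_ne_zero hz).pow _

lemma IsUnitaryForm.differentiableOn_act (hA : IsUnitaryForm A) :
    DifferentiableOn ℂ (act A) (ball n) := fun _ hz =>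
  (hasFDerivAt_act (hA.denom_ne_zero hz)).differentiableAt.differentiableWithinAt

end Kernel

section Transitivity

variable {n : ℕ}

lemma zero_mem_ball : (0 : Fin n → ℂ) ∈ ball n := by
  simp [ball]

lemma herm_add_left (u u' v : Fin (n + 1) → ℂ) : herm (u + u') v = herm u v + herm u' v := by
  simp only [herm, Pi.add_apply, add_mul, Finset.sum_add_distrib]
  ring

lemma star_herm (u v : Fin (n + 1) → ℂ) : star (herm u v) = herm v u := by
  simp [herm, star_sum, mul_comm]

lemma herm_add_right (u v v' : Fin (n + 1) → ℂ) : herm u (v + v') = herm u v + herm u v' := by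
  rw [← star_herm, herm_add_left, star_add, star_herm, star_herm]

lemma herm_smul_left (a : ℂ) (u v : Fin (n + 1) → ℂ) : herm (a • u) v = a * herm u v := by
  simpa using herm_smul_smul a 1 u v

lemma herm_smul_right (b : ℂ) (u v : Fin (n + 1) → ℂ) : herm u (b • v) = star b * herm u v := by
  simpa using herm_smul_smul 1 b u v

/-- The unitary reflection in the orthogonal complement of `a`. -/
noncomputable def reflection (a : Fin (n + 1) → ℂ) : Matrix (Fin (n + 1)) (Fin (n + 1)) ℂ :=
  1 + Matrix.vecMulVec a ((-2 / herm a a) •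
    fun i => if i = Fin.last n then -star (a i) else star (a i))

lemma dotProduct_eq_herm (a u : Fin (n + 1) → ℂ) :
    (fun i => if i = Fin.last n then -star (a i) else star (a i)) ⬝ᵥ u = herm u a := by
  simp [dotProduct, herm, Fin.sum_univ_castSucc, Fin.castSucc_ne_last, mul_comm, sub_eq_add_neg]

lemma reflection_mulVec (a u : Fin (n + 1) → ℂ) :
    reflection a *ᵥ u = u + (-2 / herm a a * herm u a) • a := by
  rw [reflection, Matrix.add_mulVec, Matrix.one_mulVec, Matrix.vecMulVec_mulVec,
    smul_dotProduct, dotProduct_eq_herm]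
  ext i
  simp only [Pi.add_apply, Pi.smul_apply, MulOpposite.smul_eq_mul_unop, MulOpposite.unop_op,
    smul_eq_mul]
  ring

lemma isUnitaryForm_reflection {a : Fin (n + 1) → ℂ} (ha : herm a a ≠ 0) :
    IsUnitaryForm (reflection a) := by
  have hs : star (herm a a) = herm a a := star_herm a a
  constructor
  · rw [reflection, Matrix.vecMulVec_eq Unit,
      Matrix.det_one_add_replicateCol_mul_replicateRow, smul_dotProduct, dotProduct_eq_herm,
      smul_eq_mul, div_mul_cancel₀ _ ha]
    norm_num
  · intro u v
    simp only [reflection_mulVec, herm_add_left, herm_add_right, herm_smul_left,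
      herm_smul_right, star_mul', star_div₀, star_neg, hs, star_herm]
    rw [show star (2 : ℂ) = 2 by simp]
    field_simp
    ring

lemma exists_isUnitaryForm_act_zero {w : Fin n → ℂ} (hw : w ∈ ball n) :
    ∃ R : Matrix (Fin (n + 1)) (Fin (n + 1)) ℂ, IsUnitaryForm R ∧ act R 0 = w := by
  have hpos := one_sub_pos_of_mem_ball hw
  set t : ℝ := (Real.sqrt (1 - ∑ i, ‖w i‖ ^ 2))⁻¹ with ht
  have htpos : 0 < t := inv_pos.2 (Real.sqrt_pos.2 hpos)
  have ht2 : t ^ 2 * (∑ i, ‖w i‖ ^ 2 - 1) = -1 := by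
    rw [ht, inv_pow, Real.sq_sqrt hpos.le, ← neg_sub 1, mul_neg, inv_mul_cancel₀ hpos.ne']
  have ht2' : (t : ℂ) ^ 2 * pair w w = -1 := by
    rw [pair_self]
    exact_mod_cast ht2
  have htne : (1 + t : ℂ) ≠ 0 := by exact_mod_cast (by positivity : 1 + t ≠ 0)
  have h00 : pair (0 : Fin n → ℂ) 0 = -1 := by simp [pair]
  have h0w : pair (0 : Fin n → ℂ) w = -1 := by simp [pair]
  have hw0 : pair w (0 : Fin n → ℂ) = -1 := by simp [pair]
  set a : Fin (n + 1) → ℂ := snoc1 0 + (t : ℂ) • snoc1 w with ha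
  have haa : herm a a = -2 * (1 + t) := by
    simp only [ha, herm_add_left, herm_add_right, herm_smul_left, herm_smul_right, herm_snoc1,
      h00, h0w, hw0]
    simp only [Complex.star_def, Complex.conj_ofReal]
    linear_combination ht2'
  have h0a : herm (snoc1 0) a = -(1 + t) := by
    simp only [ha, herm_add_right, herm_smul_right, herm_snoc1, h00, h0w]
    simp only [Complex.star_def, Complex.conj_ofReal]
    ring
  have hne : herm a a ≠ 0 := by
    rw [haa]
    exact mul_ne_zero (by norm_num) htne
  refine ⟨reflection a, isUnitaryForm_reflection hne, ?_⟩
  have hR : reflection a *ᵥ snoc1 0 = (-t : ℂ) • snoc1 w := by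
    rw [reflection_mulVec, haa, h0a, show -2 / (-2 * (1 + t : ℂ)) * -(1 + t : ℂ) = -1 by
      field_simp, ha]
    module
  ext j
  rw [act_apply, ← mulVec_snoc1_last, hR]
  simp [htpos.ne']

end Transitivity

section MeanValue

variable {n : ℕ}

lemma measurePreserving_circle_smul (c : Circle) :
    MeasurePreserving (fun z : Fin n → ℂ => (c : ℂ) • z) := by
  have := volume_preserving_pi (ι := Fin n) (f := fun _ => rotation c)
    fun _ => (rotation c).measurePreserving
  exact this

lemma smul_mem_ball {c : ℂ} (hc : ‖c‖ ≤ 1) {z : Fin n → ℂ} (hz : z ∈ ball n) :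
    c • z ∈ ball n := by
  have hz' : ∑ i, ‖z i‖ ^ 2 < 1 := hz
  refine lt_of_le_of_lt (Finset.sum_le_sum fun i _ => ?_) hz'
  rw [Pi.smul_apply, norm_smul]
  gcongr
  exact mul_le_of_le_one_left (norm_nonneg _) hc

lemma preimage_circle_smul_ball (c : Circle) :
    (fun z : Fin n → ℂ => (c : ℂ) • z) ⁻¹' ball n = ball n := by
  ext z
  simp [ball, Circle.norm_coe]

lemma measurableEmbedding_circle_smul (c : Circle) :
    MeasurableEmbedding (fun z : Fin n → ℂ => (c : ℂ) • z) :=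
  (Homeomorph.smulOfNeZero (c : ℂ) c.coe_ne_zero).measurableEmbedding

lemma integral_circle_smul {G : (Fin n → ℂ) → ℂ} (hG : DifferentiableOn ℂ G (ball n))
    {z : Fin n → ℂ} (hz : z ∈ ball n) :
    ∫ θ in (0 : ℝ)..2 * Real.pi, G ((Circle.exp θ : ℂ) • z) = 2 * Real.pi * G 0 := by
  have hd : DiffContOnCl ℂ (fun t : ℂ => G (t • z)) (Metric.ball 0 |1|) := by
    apply DifferentiableOn.diffContOnCl
    refine hG.comp (by fun_prop) fun t ht => smul_mem_ball ?_ hz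
    rw [abs_one, closure_ball _ one_ne_zero] at ht
    simpa using ht
  have h := hd.circleAverage
  rw [Real.circleAverage_def] at h
  simp only [circleMap, zero_add, ofReal_one, one_mul, zero_smul] at h
  rw [← h]
  simp only [Circle.coe_exp, Complex.real_smul]
  push_cast
  rw [mul_inv_cancel_left₀ (by exact_mod_cast Real.two_pi_pos.ne')]

lemma setIntegral_circle_smul {E : Type*} [NormedAddCommGroup E] [NormedSpace ℝ E]
    (u : (Fin n → ℂ) → E) (c : Circle) :
    ∫ z in ball n, u ((c : ℂ) • z) = ∫ z in ball n, u z := by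
  have := (measurePreserving_circle_smul c).setIntegral_preimage_emb
    (measurableEmbedding_circle_smul c) u (ball n)
  rwa [preimage_circle_smul_ball] at this

lemma integrableOn_circle_smul {f : (Fin n → ℂ) → ℂ} (hint : IntegrableOn f (ball n))
    (c : Circle) : IntegrableOn (fun z => f ((c : ℂ) • z)) (ball n) := by
  have := (measurePreserving_circle_smul c).integrableOn_comp_preimage
    (measurableEmbedding_circle_smul c) (f := f) (s := ball n)
  rw [preimage_circle_smul_ball] at this
  exact this.2 hint

lemma integrable_prod_circle_smul {f : (Fin n → ℂ) → ℂ} (hfc : ContinuousOn f (ball n))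
    (hint : IntegrableOn f (ball n)) :
    Integrable (fun p : ℝ × (Fin n → ℂ) => f ((Circle.exp p.1 : ℂ) • p.2))
      ((volume.restrict (Set.Ioc 0 (2 * Real.pi))).prod (volume.restrict (ball n))) := by
  have hsm : Continuous fun p : ℝ × (Fin n → ℂ) => (Circle.exp p.1 : ℂ) • p.2 := by
    simp only [Circle.coe_exp]
    fun_prop
  have hmaps : Set.MapsTo (fun p : ℝ × (Fin n → ℂ) => (Circle.exp p.1 : ℂ) • p.2)
      (Set.Ioc 0 (2 * Real.pi) ×ˢ ball n) (ball n) :=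
    fun p hp => smul_mem_ball (Circle.norm_coe _).le hp.2
  have hcont := hfc.comp hsm.continuousOn hmaps
  rw [integrable_prod_iff]
  · refine ⟨Eventually.of_forall fun θ => integrableOn_circle_smul hint (Circle.exp θ), ?_⟩
    have (θ : ℝ) : ∫ z in ball n, ‖f ((Circle.exp θ : ℂ) • z)‖ = ∫ z in ball n, ‖f z‖ :=
      setIntegral_circle_smul (fun z => ‖f z‖) _
    simp only [this]
    exact integrable_const _
  · rw [Measure.prod_restrict]
    exact hcont.aestronglyMeasurable (measurableSet_Ioc.prod measurableSet_ball)

lemma integral_mul_radial {G : (Fin n → ℂ) → ℂ} (hG : DifferentiableOn ℂ G (ball n)) (s : ℕ)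
    (hint : IntegrableOn (fun z => G z * (((1 - ∑ i, ‖z i‖ ^ 2) ^ s : ℝ) : ℂ)) (ball n)) :
    ∫ z in ball n, G z * (((1 - ∑ i, ‖z i‖ ^ 2) ^ s : ℝ) : ℂ) =
      G 0 * ((Real.pi ^ n * s.factorial / (n + s).factorial : ℝ) : ℂ) := by
  obtain ⟨ρ, hρ⟩ : ∃ ρ : (Fin n → ℂ) → ℝ, ρ = fun z => (1 - ∑ i, ‖z i‖ ^ 2) ^ s := ⟨_, rfl⟩
  have hρrot (c : Circle) (z : Fin n → ℂ) : ρ ((c : ℂ) • z) = ρ z := by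
    simp [hρ, Circle.norm_coe]
  have hρpos (z : Fin n → ℂ) (hz : z ∈ ball n) : 0 ≤ ρ z := by
    rw [hρ]
    exact pow_nonneg (one_sub_pos_of_mem_ball hz).le _
  have hρc : Continuous ρ := by
    rw [hρ]
    fun_prop
  have hmass : ∫ z in ball n, ρ z = Real.pi ^ n * s.factorial / (n + s).factorial := by
    rw [integral_eq_lintegral_of_nonneg_ae
      ((ae_restrict_mem measurableSet_ball).mono fun z hz => hρpos z hz)
      hρc.aestronglyMeasurable, hρ, lintegral_ball_pow, ENNReal.toReal_ofReal (by positivity)]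
  have hfi : IntegrableOn (fun z => G z * (ρ z : ℂ)) (ball n) := by rwa [hρ]
  suffices ∫ z in ball n, G z * (ρ z : ℂ) =
      G 0 * ((Real.pi ^ n * s.factorial / (n + s).factorial : ℝ) : ℂ) by rwa [hρ] at this
  have hprod := integrable_prod_circle_smul
    (hG.continuousOn.mul (continuous_ofReal.comp hρc).continuousOn) hfi
  have hswap := integral_integral_swap
    (f := fun θ z => G ((Circle.exp θ : ℂ) • z) * (ρ ((Circle.exp θ : ℂ) • z) : ℂ)) hprod
  have h1 (θ : ℝ) : ∫ z in ball n, G ((Circle.exp θ : ℂ) • z) *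
      (ρ ((Circle.exp θ : ℂ) • z) : ℂ) = ∫ z in ball n, G z * (ρ z : ℂ) :=
    setIntegral_circle_smul (fun z => G z * (ρ z : ℂ)) _
  have h2 : ∫ z in ball n, ∫ θ in Set.Ioc 0 (2 * Real.pi), G ((Circle.exp θ : ℂ) • z) *
      (ρ ((Circle.exp θ : ℂ) • z) : ℂ) = ∫ z in ball n, 2 * Real.pi * G 0 * (ρ z : ℂ) := by
    refine setIntegral_congr_fun measurableSet_ball fun z hz => ?_
    simp only [hρrot]
    rw [integral_mul_const, ← integral_circle_smul hG hz,
      intervalIntegral.integral_of_le (by positivity)]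
  simp only [h1] at hswap
  rw [h2, integral_const_mul, integral_complex_ofReal, hmass, integral_const, mul_assoc] at hswap
  have h2pi : (2 * Real.pi : ℂ) ≠ 0 := by
    exact_mod_cast Real.two_pi_pos.ne'
  refine mul_left_cancel₀ h2pi (Eq.trans ?_ hswap)
  simp [Real.pi_pos.le]

end MeanValue

section Reproducing

variable {n : ℕ}

lemma Kc_zero_right (z : Fin n → ℂ) :
    Kc z 0 = (((Nat.factorial n : ℝ) / Real.pi ^ n : ℝ) : ℂ) := by
  simp [Kc, pair]

lemma normSq_jac_mul_reproducing {R : Matrix (Fin (n + 1)) (Fin (n + 1)) ℂ}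
    (hR : IsUnitaryForm R) (g : (Fin n → ℂ) → ℂ) (m : ℕ) {z : Fin n → ℂ} (hz : z ∈ ball n) :
    ‖jac R z‖ ^ 2 • (g (act R z) * star (Kc (act R z) (act R 0) ^ (m + 1)) *
        (((Kr (act R z) ^ m)⁻¹ : ℝ) : ℂ)) =
      g (act R z) * (jac R z / jac R 0) ^ (m + 1) *
        (((Nat.factorial n : ℝ) / Real.pi ^ n : ℝ) : ℂ) *
        (((1 - ∑ i, ‖z i‖ ^ 2) ^ ((n + 1) * m) : ℝ) : ℂ) := by
  have hJ := hR.jac_ne_zero hz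
  have hJ0 := hR.jac_ne_zero (zero_mem_ball (n := n))
  have hJs : star (jac R z) ≠ 0 := star_ne_zero.2 hJ
  have hκ : ((Nat.factorial n : ℝ) / Real.pi ^ n) ≠ 0 := (factorial_div_pi_pow_pos n).ne'
  have hKc := hR.Kc_act hz (zero_mem_ball (n := n))
  rw [Kc_zero_right] at hKc
  have hKr : (Kr (act R z) ^ m)⁻¹ = (‖jac R z‖ ^ 2) ^ m * (Kr z ^ m)⁻¹ := by
    rw [← hR.Kr_act hz, mul_pow, mul_inv, mul_comm (Kr _ ^ m)⁻¹, mul_inv_cancel_left₀]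
    exact pow_ne_zero _ (pow_ne_zero _ (norm_ne_zero_iff.2 hJ))
  have hN : ((‖jac R z‖ ^ 2 : ℝ) : ℂ) = jac R z * star (jac R z) := by
    rw [mul_star_eq_normSq]
  rw [hKr, Kr_pow_inv, Complex.real_smul]
  set κ := (Nat.factorial n : ℝ) / Real.pi ^ n
  have hK : star (Kc (act R z) (act R 0)) = κ / (star (jac R z) * jac R 0) := by
    rw [eq_div_iff (mul_ne_zero hJs hJ0)]
    have := congrArg star hKc
    simp only [star_mul', star_star] at this
    rw [mul_assoc] at this
    rw [this]
    simp
  rw [star_pow, hK, ofReal_mul, ofReal_mul, ofReal_pow (‖jac R z‖ ^ 2), hN, ofReal_pow κ⁻¹,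
    ofReal_inv]
  have hκ' : (κ : ℂ) ≠ 0 := by exact_mod_cast hκ
  simp only [div_pow, mul_pow, pow_succ, inv_pow]
  field_simp

/-- The weighted Bergman reproducing formula. -/
lemma integral_mul_Kc {g : (Fin n → ℂ) → ℂ} (hg : DifferentiableOn ℂ g (ball n))
    {w : Fin n → ℂ} (hw : w ∈ ball n) (m : ℕ)
    (hint : IntegrableOn (fun z => g z * star (Kc z w ^ (m + 1)) *
      (((Kr z ^ m)⁻¹ : ℝ) : ℂ)) (ball n)) :
    (cB n (m + 1) : ℂ) * ∫ z in ball n, g z * star (Kc z w ^ (m + 1)) *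
      (((Kr z ^ m)⁻¹ : ℝ) : ℂ) = g w := by
  obtain ⟨R, hR, rfl⟩ := exists_isUnitaryForm_act_zero hw
  have hJ0 := hR.jac_ne_zero (zero_mem_ball (n := n))
  have hdiff : DifferentiableOn ℂ (fun z => g (act R z) * (jac R z / jac R 0) ^ (m + 1) *
      (((Nat.factorial n : ℝ) / Real.pi ^ n : ℝ) : ℂ)) (ball n) := by
    simp only [div_eq_mul_inv (jac R _)]
    exact ((hg.comp hR.differentiableOn_act fun z hz => hR.act_mem hz).mul
      ((hR.differentiableOn_jac.mul_const _).pow _)).mul_const _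
  have hcongr := fun z hz => normSq_jac_mul_reproducing hR g m (z := z) hz
  rw [← hR.image_ball, hR.integrableOn_image_iff measurableSet_ball subset_rfl,
    integrableOn_congr_fun hcongr measurableSet_ball] at hint
  have hmv := integral_mul_radial hdiff _ hint
  rw [← setIntegral_congr_fun measurableSet_ball hcongr,
    ← hR.integral_image measurableSet_ball subset_rfl (fun z => g z *
      star (Kc z (act R 0) ^ (m + 1)) * (((Kr z ^ m)⁻¹ : ℝ) : ℂ)), hR.image_ball,
    div_self hJ0, one_pow,
    mul_one] at hmv
  rw [hmv, mul_assoc, ← ofReal_mul, mul_left_comm, cB, Nat.add_sub_cancel, ← ofReal_natCast,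
    ← ofReal_mul]
  have : ((((n + 1) * m + n).choose n : ℕ) : ℝ) * ((Nat.factorial n : ℝ) / Real.pi ^ n *
      (Real.pi ^ n * ((n + 1) * m).factorial / (n + (n + 1) * m).factorial)) = 1 := by
    have h := Nat.add_choose_mul_factorial_mul_factorial ((n + 1) * m) n
    rw [add_comm n ((n + 1) * m), ← h]
    have hc : ((((n + 1) * m + n).choose n : ℕ) : ℝ) ≠ 0 := by
      exact_mod_cast (Nat.choose_pos (Nat.le_add_left _ _)).ne'
    push_cast
    have hpi := Real.pi_ne_zero
    field_simp
  rw [this, ofReal_one, mul_one]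

end Reproducing

section Bounded

variable {n : ℕ} {G : DiscreteGroup n}

lemma le_Kr {z : Fin n → ℂ} (hz : z ∈ ball n) : (Nat.factorial n : ℝ) / Real.pi ^ n ≤ Kr z := by
  refine le_mul_of_one_le_right (factorial_div_pi_pow_pos n).le (one_le_pow₀ ?_)
  refine one_le_inv_iff₀.2 ⟨one_sub_pos_of_mem_ball hz, ?_⟩
  exact sub_le_self _ (Finset.sum_nonneg fun i _ => by positivity)

lemma Automorphic.normSq_div_Kr_act {k : ℕ} {g : (Fin n → ℂ) → ℂ} (hg : Automorphic G k g)
    {A : Matrix (Fin (n + 1)) (Fin (n + 1)) ℂ} (hA : A ∈ G.Γ) {z : Fin n → ℂ}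
    (hz : z ∈ ball n) :
    ‖g (act A z)‖ ^ 2 / Kr (act A z) ^ k = ‖g z‖ ^ 2 / Kr z ^ k := by
  have hU := IsUnitaryForm.of_mem_SU (G.sub_SU hA)
  have hJ : ‖jac A z‖ ≠ 0 := norm_ne_zero_iff.2 (hU.jac_ne_zero hz)
  rw [← hU.Kr_act hz, ← hg A hA z hz, norm_mul, norm_pow, mul_pow, mul_pow, ← pow_mul, ← pow_mul,
    mul_comm k 2, mul_div_mul_right _ _ (pow_ne_zero _ hJ)]

lemma Htilde.exists_bound {m : ℕ} (hm : 1 ≤ m) {g : (Fin n → ℂ) → ℂ}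
    (hg : Htilde G (m + 1) g) : ∃ C, ∀ z ∈ ball n, ‖g z‖ * (Kr z ^ m)⁻¹ ≤ C := by
  obtain ⟨F, hFb, hFc, hcov⟩ := G.cocompact
  have hcont : ContinuousOn (fun z => ‖g z‖ ^ 2 / Kr z ^ (m + 1)) F :=
    ((hg.1.continuousOn.mono hFb).norm.pow 2).div ((continuousOn_Kr.mono hFb).pow _)
      fun z hz => (pow_pos (Kr_pos (hFb hz)) _).ne'
  obtain ⟨C, hC⟩ := hFc.bddAbove_image hcont
  set κ := (Nat.factorial n : ℝ) / Real.pi ^ n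
  have hκ : 0 < κ := factorial_div_pi_pow_pos n
  refine ⟨Real.sqrt (C / κ ^ (m - 1)), fun z hz => Real.le_sqrt_of_sq_le ?_⟩
  obtain ⟨A, hA, hAz⟩ := hcov z hz
  have hb : ‖g z‖ ^ 2 / Kr z ^ (m + 1) ≤ C := by
    rw [← hg.2.normSq_div_Kr_act hA hz]
    exact hC (Set.mem_image_of_mem _ hAz)
  have hK := Kr_pos hz
  have hsplit : (Kr z ^ m) ^ 2 = Kr z ^ (m + 1) * Kr z ^ (m - 1) := by
    rw [← pow_mul, ← pow_add]
    congr 1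
    omega
  rw [← div_eq_mul_inv, div_pow, hsplit, ← div_div]
  gcongr
  · exact (by positivity : (0 : ℝ) ≤ ‖g z‖ ^ 2 / Kr z ^ (m + 1)).trans hb
  · exact le_Kr hz

lemma le_norm_neg_pair {z w : Fin n → ℂ} (hz : z ∈ ball n) :
    (1 - ∑ i, ‖w i‖ ^ 2) / 2 ≤ ‖-pair z w‖ := by
  have hz' : ∑ i, ‖z i‖ ^ 2 < 1 := hz
  have hsum : ‖∑ i, z i * star (w i)‖ ≤ (∑ i, ‖z i‖ ^ 2 + ∑ i, ‖w i‖ ^ 2) / 2 := by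
    rw [← Finset.sum_add_distrib, Finset.sum_div]
    refine (norm_sum_le _ _).trans (Finset.sum_le_sum fun i _ => ?_)
    rw [norm_mul, norm_star]
    linarith [two_mul_le_add_sq ‖z i‖ ‖w i‖]
  have := norm_sub_norm_le (1 : ℂ) (∑ i, z i * star (w i))
  rw [norm_one] at this
  rw [pair, neg_sub]
  linarith

lemma norm_Kc_le {z w : Fin n → ℂ} (hz : z ∈ ball n) (hw : w ∈ ball n) :
    ‖Kc z w‖ ≤ 2 ^ (n + 1) * Kr w := by
  have hpos := one_sub_pos_of_mem_ball hw
  have hinv : ‖-pair z w‖⁻¹ ≤ 2 * (1 - ∑ i, ‖w i‖ ^ 2)⁻¹ := by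
    refine (inv_anti₀ (by positivity) (le_norm_neg_pair hz)).trans_eq ?_
    rw [inv_div, div_eq_mul_inv]
  rw [Kc, norm_mul, norm_pow, norm_inv, Complex.norm_real,
    Real.norm_of_nonneg (factorial_div_pi_pow_pos n).le, Kr, mul_left_comm, ← mul_pow]
  gcongr

lemma neg_pair_ne_zero {z w : Fin n → ℂ} (hz : z ∈ ball n) (hw : w ∈ ball n) :
    -pair z w ≠ 0 :=
  norm_pos_iff.1 <| (half_pos (one_sub_pos_of_mem_ball hw)).trans_le (le_norm_neg_pair hz)

lemma continuousOn_Kc :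
    ContinuousOn (fun p : (Fin n → ℂ) × (Fin n → ℂ) => Kc p.1 p.2) (ball n ×ˢ ball n) := by
  have hc : Continuous fun p : (Fin n → ℂ) × (Fin n → ℂ) => -pair p.1 p.2 := by
    unfold pair
    fun_prop
  exact continuousOn_const.mul
    ((hc.continuousOn.inv₀ fun p hp => neg_pair_ne_zero hp.1 hp.2).pow _)

end Bounded

section Curve

variable {n : ℕ} {G : DiscreteGroup n}

lemma act_mem_ball_of_herm_neg {A : Matrix (Fin (n + 1)) (Fin (n + 1)) ℂ} {z : Fin n → ℂ}
    (h : (herm (A *ᵥ snoc1 z) (A *ᵥ snoc1 z)).re < 0) : denom A z ≠ 0 ∧ act A z ∈ ball n := by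
  have hd : denom A z ≠ 0 := by
    intro hd
    refine h.not_ge ?_
    rw [herm, mulVec_snoc1_last, hd]
    simp only [mul_star_eq_normSq, zero_mul, sub_zero]
    rw [← ofReal_sum, ofReal_re]
    exact Finset.sum_nonneg fun i _ => by positivity
  refine ⟨hd, ?_⟩
  rw [mulVec_snoc1 hd, herm_smul_smul, herm_snoc1, mul_star_eq_normSq, pair_self, ← ofReal_mul,
    ofReal_re] at h
  exact sub_neg.1 (neg_of_mul_neg_right h (sq_nonneg _))

lemma HypElt.mulVec_curve (hn : 0 < n) (H : HypElt n G) (x : ℝ) :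
    H.A *ᵥ snoc1 (curve n hn x) = ((x + 1) * (pair H.X H.Y)⁻¹ : ℂ) • snoc1 H.X +
      ((x - 1) / 2 : ℂ) • snoc1 H.Y := by
  ext i
  have h1 : ((lastI n hn : Fin n) : ℕ) = n - 1 := rfl
  have h2 : ¬ n < n - 1 := by omega
  have h3 : n ≠ n - 1 := by omega
  simp only [Matrix.mulVec, dotProduct, Fin.sum_univ_castSucc, snoc1_castSucc, snoc1_last, curve,
    mul_ite, mul_zero, Finset.sum_ite_eq', Finset.mem_univ, if_true, HypElt.A,
    Amat, Matrix.of_apply, Fin.val_castSucc, Fin.val_last, h1, h2, h3, lt_irrefl, dite_false,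
    if_false, Pi.add_apply, Pi.sub_apply, Pi.smul_apply, smul_eq_mul, mul_one]
  ring

lemma HypElt.X_ne_Y (H : HypElt n G) : H.X ≠ H.Y := by
  intro h
  have h1 := H.eigX
  rw [h, H.eigY] at h1
  have h2 := congrFun h1 (Fin.last n)
  simp only [Pi.smul_apply, snoc1_last, smul_eq_mul, mul_one] at h2
  have h3 : H.lam⁻¹ = H.lam := by exact_mod_cast h2
  have hl := H.lam_sq
  have h0 : H.lam ≠ 0 := by
    rintro h0
    rw [h0] at hl
    norm_num at hl
  rw [sq] at hl
  nth_rewrite 1 [← h3] at hl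
  rw [inv_mul_cancel₀ h0] at hl
  exact lt_irrefl _ hl

lemma HypElt.star_pair_X_Y (H : HypElt n G) : star (pair H.X H.Y) = pair H.X H.Y := by
  simp only [pair, star_sub, star_sum, star_mul', star_star, star_one]
  congr 1
  refine Finset.sum_congr rfl fun i _ => ?_
  simp only [Complex.star_def, Complex.conj_eq_iff_im.2 (H.X_real i),
    Complex.conj_eq_iff_im.2 (H.Y_real i)]

lemma HypElt.pair_X_Y_ne_zero (H : HypElt n G) : pair H.X H.Y ≠ 0 := by
  intro h
  refine H.X_ne_Y (funext fun i => ?_)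
  have hre : ∑ i, (H.X i * star (H.Y i)).re = 1 := by
    rw [← Complex.re_sum, sub_eq_zero.1 h, one_re]
  have hsum : ∑ i, ‖H.X i - H.Y i‖ ^ 2 = 0 := by
    simp only [← Complex.normSq_eq_norm_sq, Complex.normSq_sub, ← Complex.star_def]
    rw [Finset.sum_sub_distrib, Finset.sum_add_distrib, ← Finset.mul_sum, hre]
    simp only [Complex.normSq_eq_norm_sq, H.X_bd, H.Y_bd]
    norm_num
  have := (Finset.sum_eq_zero_iff_of_nonneg fun i _ => by positivity).1 hsum i (Finset.mem_univ _)
  simpa [sub_eq_zero] using this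

lemma HypElt.herm_mulVec_curve (hn : 0 < n) (H : HypElt n G) (x : ℝ) :
    herm (H.A *ᵥ snoc1 (curve n hn x)) (H.A *ᵥ snoc1 (curve n hn x)) = ((x ^ 2 - 1 : ℝ) : ℂ) := by
  have hs := H.star_pair_X_Y
  have hp := H.pair_X_Y_ne_zero
  have hYX : pair H.Y H.X = pair H.X H.Y := by rw [← star_pair, hs]
  have hXX : pair H.X H.X = 0 := by rw [pair_self, H.X_bd]; simp
  have hYY : pair H.Y H.Y = 0 := by rw [pair_self, H.Y_bd]; simp
  simp only [H.mulVec_curve hn, herm_add_left, herm_add_right, herm_smul_smul, herm_snoc1, hXX,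
    hYY, hYX, star_mul', star_inv₀, hs, star_div₀, star_sub, star_add, star_one]
  simp only [Complex.star_def, Complex.conj_ofReal, map_ofNat]
  push_cast
  field_simp
  ring

lemma sum_norm_sq_curve (hn : 0 < n) (x : ℝ) : ∑ i, ‖curve n hn x i‖ ^ 2 = x ^ 2 := by
  simp [curve, apply_ite norm, ite_pow]

lemma HypElt.T_mem (H : HypElt n G) : 0 ≤ H.T ∧ H.T < 1 := by
  have hl := H.lam_sq
  constructor
  · exact div_nonneg (by linarith) (by linarith)
  · rw [HypElt.T, div_lt_one (by linarith)]
    linarith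

lemma HypElt.sq_lt_one (H : HypElt n G) {x : ℝ} (hx : x ∈ Set.Icc 0 H.T) : x ^ 2 < 1 := by
  have := H.T_mem
  nlinarith [hx.1, hx.2]

lemma curve_mem_ball (hn : 0 < n) {x : ℝ} (hx : x ^ 2 < 1) : curve n hn x ∈ ball n :=
  (sum_norm_sq_curve hn x).trans_lt hx

lemma HypElt.act_curve_mem (hn : 0 < n) (H : HypElt n G) {x : ℝ} (hx : x ^ 2 < 1) :
    denom H.A (curve n hn x) ≠ 0 ∧ act H.A (curve n hn x) ∈ ball n := by
  apply act_mem_ball_of_herm_neg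
  rw [H.herm_mulVec_curve, ofReal_re]
  linarith

lemma continuous_curve (hn : 0 < n) : Continuous (curve n hn) := by
  refine continuous_pi fun i => ?_
  unfold curve
  split_ifs
  · exact continuous_ofReal
  · exact continuous_const

lemma HypElt.continuousOn_act_curve (hn : 0 < n) (H : HypElt n G) :
    ContinuousOn (fun x => act H.A (curve n hn x)) (Set.Icc 0 H.T) := fun _ hx =>
  ((hasFDerivAt_act (H.act_curve_mem hn (H.sq_lt_one hx)).1).continuousAt.comp
    (continuous_curve hn).continuousAt).continuousWithinAt

lemma HypElt.continuousOn_weight (hn : 0 < n) (H : HypElt n G) (a b : ℝ) :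
    ContinuousOn (fun x => Kr (act H.A (curve n hn x)) ^ a * Kr (curve n hn x) ^ b)
      (Set.Icc 0 H.T) := by
  have h1 : Set.MapsTo (fun x => act H.A (curve n hn x)) (Set.Icc 0 H.T) (ball n) :=
    fun _ hx => (H.act_curve_mem hn (H.sq_lt_one hx)).2
  have h2 : Set.MapsTo (curve n hn) (Set.Icc 0 H.T) (ball n) :=
    fun _ hx => curve_mem_ball hn (H.sq_lt_one hx)
  exact ((continuousOn_Kr.comp (H.continuousOn_act_curve hn) h1).rpow_const
    fun _ hx => Or.inl (Kr_pos (h1 hx)).ne').mul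
    ((continuousOn_Kr.comp (continuous_curve hn).continuousOn h2).rpow_const
    fun _ hx => Or.inl (Kr_pos (h2 hx)).ne')

end Curve

section Unfolding

variable {n : ℕ} {G : DiscreteGroup n} {F : Set (Fin n → ℂ)}

lemma volume_ball_lt_top : volume (ball n) < ⊤ := by
  have := lintegral_ball_pow n 0
  simp only [pow_zero, ENNReal.ofReal_one, setLIntegral_one] at this
  rw [this]
  exact ENNReal.ofReal_lt_top

lemma DiscreteGroup.countable (G : DiscreteGroup n) : Countable G.Γ := by
  have := G.discrete
  have : SecondCountableTopology (Matrix (Fin (n + 1)) (Fin (n + 1)) ℂ) :=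
    inferInstanceAs (SecondCountableTopology (Fin (n + 1) → Fin (n + 1) → ℂ))
  exact countable_of_Lindelof_of_discrete

lemma DiscreteGroup.isUnitaryForm (G : DiscreteGroup n) (A : G.Γ) :
    IsUnitaryForm (A : Matrix (Fin (n + 1)) (Fin (n + 1)) ℂ) :=
  .of_mem_SU (G.sub_SU A.2)

lemma IsFundDom.iUnion_image (hF : IsFundDom G F) :
    ⋃ A : G.Γ, act (A : Matrix (Fin (n + 1)) (Fin (n + 1)) ℂ) '' F = ball n := by
  refine Set.Subset.antisymm (Set.iUnion_subset fun A => ?_) fun z hz => ?_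
  · rintro _ ⟨z, hz, rfl⟩
    exact (G.isUnitaryForm A).act_mem (hF.1 hz)
  · obtain ⟨A, hA, hAz⟩ := hF.2.2.1 z hz
    exact Set.mem_iUnion.2 ⟨⟨A⁻¹, G.inv_mem hA⟩, _, hAz,
      (G.isUnitaryForm ⟨A, hA⟩).act_inv_act hz⟩

lemma IsFundDom.aedisjoint_image (hF : IsFundDom G F) :
    Pairwise (Function.onFun (AEDisjoint volume)
      fun A : G.Γ => act (A : Matrix (Fin (n + 1)) (Fin (n + 1)) ℂ) '' F) := by
  intro A B hAB
  have hA := G.isUnitaryForm A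
  have hB := G.isUnitaryForm B
  have hne : (B : Matrix (Fin (n + 1)) (Fin (n + 1)) ℂ)⁻¹ * A ≠ 1 := fun h => hAB <|
    Subtype.ext <| by
      rw [← Matrix.mul_one (B : Matrix (Fin (n + 1)) (Fin (n + 1)) ℂ), ← h,
        Matrix.mul_nonsing_inv_cancel_left _ _ hB.isUnit_det]
  have hnull := hF.2.2.2 _ (G.mul_mem (G.inv_mem B.2) A.2) hne
  refine measure_mono_null ?_ (addHaar_image_eq_zero_of_differentiableOn_of_addHaar_eq_zero
    volume (f := act (A : Matrix (Fin (n + 1)) (Fin (n + 1)) ℂ))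
    ((hA.differentiableOn_act.restrictScalars ℝ).mono fun z hz => hF.1 hz.1) hnull)
  rintro _ ⟨⟨z, hz, rfl⟩, w, hw, hwz⟩
  refine ⟨z, ⟨hz, ?_⟩, rfl⟩
  rwa [act_mul (hA.denom_ne_zero (hF.1 hz)), ← hwz, hB.act_inv_act (hF.1 hw)]

lemma IsFundDom.nullMeasurableSet_image (hF : IsFundDom G F) (A : G.Γ) :
    NullMeasurableSet (act (A : Matrix (Fin (n + 1)) (Fin (n + 1)) ℂ) '' F) :=
  ((G.isUnitaryForm A).measurableSet_image hF.2.1 hF.1).nullMeasurableSet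

lemma IsFundDom.integrableOn_smul_act {E : Type*} [NormedAddCommGroup E] [NormedSpace ℝ E]
    (hF : IsFundDom G F) {Φ : (Fin n → ℂ) → E} (hΦ : IntegrableOn Φ (ball n)) (A : G.Γ) :
    IntegrableOn (fun z => ‖jac (A : Matrix (Fin (n + 1)) (Fin (n + 1)) ℂ) z‖ ^ 2 •
      Φ (act (A : Matrix (Fin (n + 1)) (Fin (n + 1)) ℂ) z)) F := by
  rw [← (G.isUnitaryForm A).integrableOn_image_iff hF.2.1 hF.1]
  exact hΦ.mono_set <| (Set.subset_iUnion _ A).trans_eq hF.iUnion_image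

lemma IsFundDom.hasSum_integral {E : Type*} [NormedAddCommGroup E] [NormedSpace ℝ E]
    (hF : IsFundDom G F) {Φ : (Fin n → ℂ) → E} (hΦ : IntegrableOn Φ (ball n)) :
    HasSum (fun A : G.Γ => ∫ z in F, ‖jac (A : Matrix (Fin (n + 1)) (Fin (n + 1)) ℂ) z‖ ^ 2 •
      Φ (act (A : Matrix (Fin (n + 1)) (Fin (n + 1)) ℂ) z)) (∫ z in ball n, Φ z) := by
  have := G.countable
  simp only [← (G.isUnitaryForm _).integral_image hF.2.1 hF.1]
  have hΦ' := hΦ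
  rw [← hF.iUnion_image] at hΦ' ⊢
  exact hasSum_integral_iUnion_ae hF.nullMeasurableSet_image hF.aedisjoint_image hΦ'

/-- Unfolding an integral over the ball to a fundamental domain. -/
lemma IsFundDom.integral_tsum {E : Type*} [NormedAddCommGroup E] [NormedSpace ℝ E]
    (hF : IsFundDom G F) {Φ : (Fin n → ℂ) → E} (hΦ : IntegrableOn Φ (ball n)) :
    ∫ z in F, ∑' A : G.Γ, ‖jac (A : Matrix (Fin (n + 1)) (Fin (n + 1)) ℂ) z‖ ^ 2 •
      Φ (act (A : Matrix (Fin (n + 1)) (Fin (n + 1)) ℂ) z) = ∫ z in ball n, Φ z := by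
  have := G.countable
  rw [← integral_tsum_of_summable_integral_norm (hF.integrableOn_smul_act hΦ),
    (hF.hasSum_integral hΦ).tsum_eq]
  have := (hF.hasSum_integral hΦ.norm).summable
  simpa [norm_smul] using this

lemma IsFundDom.ae_summable (hF : IsFundDom G F) :
    ∀ᵐ z ∂volume.restrict F,
      Summable fun A : G.Γ => ‖jac (A : Matrix (Fin (n + 1)) (Fin (n + 1)) ℂ) z‖ ^ 2 := by
  have := G.countable
  have hmeas (A : G.Γ) : AEMeasurable (fun z => ENNReal.ofReal
      (‖jac (A : Matrix (Fin (n + 1)) (Fin (n + 1)) ℂ) z‖ ^ 2)) (volume.restrict F) :=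
    ((((G.isUnitaryForm A).differentiableOn_jac.continuousOn.mono hF.1).norm.pow
      2).aemeasurable hF.2.1).ennreal_ofReal
  have hfin : ∫⁻ z in F, ∑' A : G.Γ, ENNReal.ofReal
      (‖jac (A : Matrix (Fin (n + 1)) (Fin (n + 1)) ℂ) z‖ ^ 2) ≠ ⊤ := by
    rw [lintegral_tsum hmeas]
    simp only [(G.isUnitaryForm _).volume_image hF.2.1 hF.1]
    rw [← measure_iUnion₀ hF.aedisjoint_image hF.nullMeasurableSet_image, hF.iUnion_image]
    exact volume_ball_lt_top.ne
  filter_upwards [ae_lt_top' (AEMeasurable.tsum hmeas) hfin] with z hz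
  have := ENNReal.summable_toReal hz.ne
  simpa using this

end Unfolding

section Unfold

variable {n : ℕ} {G : DiscreteGroup n}

/-- The integrand of the inner product of `g` with the kernel `K(·,w)^(m+1)` over the ball. -/
noncomputable def kernelProd (g : (Fin n → ℂ) → ℂ) (m : ℕ) (w z : Fin n → ℂ) : ℂ :=
  g z * star (Kc z w ^ (m + 1)) * (((Kr z ^ m)⁻¹ : ℝ) : ℂ)

lemma Htilde.smul_kernelProd_act {m : ℕ} {g : (Fin n → ℂ) → ℂ} (hg : Htilde G (m + 1) g)
    (A : G.Γ) {z : Fin n → ℂ} (hz : z ∈ ball n) (w : Fin n → ℂ) :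
    ‖jac (A : Matrix (Fin (n + 1)) (Fin (n + 1)) ℂ) z‖ ^ 2 • kernelProd g m w (act A z) =
      g z * star (Kc (act (A : Matrix (Fin (n + 1)) (Fin (n + 1)) ℂ) z) w ^ (m + 1) *
        jac (A : Matrix (Fin (n + 1)) (Fin (n + 1)) ℂ) z ^ (m + 1)) *
        (((Kr z ^ m)⁻¹ : ℝ) : ℂ) := by
  have hU := G.isUnitaryForm A
  have hJ := hU.jac_ne_zero hz
  have hKr : (Kr (act A z) ^ m)⁻¹ = (‖jac A.1 z‖ ^ 2) ^ m * (Kr z ^ m)⁻¹ := by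
    rw [← hU.Kr_act hz, mul_pow, mul_inv, mul_comm (Kr _ ^ m)⁻¹, mul_inv_cancel_left₀]
    exact pow_ne_zero _ (pow_ne_zero _ (norm_ne_zero_iff.2 hJ))
  rw [kernelProd, hKr, ← hg.2 A A.2 z hz, Complex.real_smul, ofReal_mul, ofReal_pow (_ ^ 2),
    ← mul_star_eq_normSq, star_mul', star_pow (jac _ _)]
  ring

lemma Htilde.exists_norm_kernelProd_le {m : ℕ} (hm : 1 ≤ m) {g : (Fin n → ℂ) → ℂ}
    (hg : Htilde G (m + 1) g) : ∃ C, 0 ≤ C ∧ ∀ z ∈ ball n, ∀ w ∈ ball n,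
      ‖kernelProd g m w z‖ ≤ C * Kr w ^ (m + 1) := by
  obtain ⟨C, hC⟩ := hg.exists_bound hm
  have hC0 : 0 ≤ C := (mul_nonneg (norm_nonneg _)
    (inv_nonneg.2 (pow_nonneg (Kr_pos zero_mem_ball).le _))).trans (hC 0 zero_mem_ball)
  refine ⟨C * (2 ^ (n + 1)) ^ (m + 1), by positivity, fun z hz w hw => ?_⟩
  have hK : 0 ≤ (Kr z ^ m)⁻¹ := inv_nonneg.2 (pow_nonneg (Kr_pos hz).le _)
  calc ‖kernelProd g m w z‖ = ‖g z‖ * (Kr z ^ m)⁻¹ * ‖Kc z w‖ ^ (m + 1) := by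
        rw [kernelProd, norm_mul, norm_mul, norm_star, norm_pow, Complex.norm_real,
          Real.norm_of_nonneg hK, mul_right_comm]
    _ ≤ C * (2 ^ (n + 1) * Kr w) ^ (m + 1) := by
        gcongr
        · exact hC z hz
        · exact norm_Kc_le hz hw
    _ = C * (2 ^ (n + 1)) ^ (m + 1) * Kr w ^ (m + 1) := by rw [mul_pow, mul_assoc]

lemma continuousOn_kernelProd {g : (Fin n → ℂ) → ℂ} (hg : ContinuousOn g (ball n)) (m : ℕ) :
    ContinuousOn (fun p : (Fin n → ℂ) × (Fin n → ℂ) => kernelProd g m p.2 p.1)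
      (ball n ×ˢ ball n) := by
  have hfst : Set.MapsTo (Prod.fst : (Fin n → ℂ) × (Fin n → ℂ) → Fin n → ℂ)
      (ball n ×ˢ ball n) (ball n) := fun p hp => hp.1
  have hK := ((continuousOn_Kr.pow m).inv₀ fun z hz => (pow_pos (Kr_pos hz) m).ne').comp
    continuous_fst.continuousOn hfst
  exact ((hg.comp continuous_fst.continuousOn hfst).mul (continuousOn_Kc.pow _).star).mul
    (continuous_ofReal.comp_continuousOn hK)

lemma Htilde.integral_kernelProd {m : ℕ} (hm : 1 ≤ m) {g : (Fin n → ℂ) → ℂ}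
    (hg : Htilde G (m + 1) g) {w : Fin n → ℂ} (hw : w ∈ ball n) :
    (cB n (m + 1) : ℂ) * ∫ z in ball n, kernelProd g m w z = g w := by
  refine integral_mul_Kc hg.1 hw m ?_
  obtain ⟨C, -, hC⟩ := hg.exists_norm_kernelProd_le hm
  have hc : ContinuousOn (kernelProd g m w) (ball n) :=
    (continuousOn_kernelProd hg.1.continuousOn m).comp (f := fun z => (z, w))
      (by fun_prop) fun z hz => ⟨hz, hw⟩
  exact IntegrableOn.of_bound volume_ball_lt_top (hc.aestronglyMeasurable measurableSet_ball)
    (C * Kr w ^ (m + 1)) ((ae_restrict_mem measurableSet_ball).mono fun z hz => hC z hz w hw)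

variable {F : Set (Fin n → ℂ)} {T : ℝ} {w : ℝ → Fin n → ℂ} {ω : ℝ → ℝ}

lemma Htilde.exists_norm_kernelProd_curve_le {m : ℕ} (hm : 1 ≤ m) {g : (Fin n → ℂ) → ℂ}
    (hg : Htilde G (m + 1) g) (hwc : ContinuousOn w (Set.Icc 0 T))
    (hwb : Set.MapsTo w (Set.Icc 0 T) (ball n)) (hω : ContinuousOn ω (Set.Icc 0 T)) :
    ∃ C, ∀ z ∈ ball n, ∀ x ∈ Set.Icc 0 T, ‖kernelProd g m (w x) z * (ω x : ℂ)‖ ≤ C := by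
  obtain ⟨C, hC0, hC⟩ := hg.exists_norm_kernelProd_le hm
  obtain ⟨D, hD⟩ := isCompact_Icc.bddAbove_image
    ((((continuousOn_Kr.comp hwc hwb).pow (m + 1)).mul hω.norm))
  refine ⟨C * D, fun z hz x hx => ?_⟩
  rw [norm_mul, Complex.norm_real]
  calc _ ≤ C * Kr (w x) ^ (m + 1) * ‖ω x‖ := by
        gcongr
        exact hC z hz _ (hwb hx)
    _ = C * (Kr (w x) ^ (m + 1) * ‖ω x‖) := mul_assoc _ _ _
    _ ≤ C * D := by
        gcongr
        exact hD (Set.mem_image_of_mem _ hx)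

lemma continuousOn_kernelProd_curve {g : (Fin n → ℂ) → ℂ} (hg : ContinuousOn g (ball n)) (m : ℕ)
    (hwc : ContinuousOn w (Set.Icc 0 T)) (hwb : Set.MapsTo w (Set.Icc 0 T) (ball n))
    (hω : ContinuousOn ω (Set.Icc 0 T)) :
    ContinuousOn (fun p : (Fin n → ℂ) × ℝ => kernelProd g m (w p.2) p.1 * (ω p.2 : ℂ))
      (ball n ×ˢ Set.Icc 0 T) := by
  have hsnd : Set.MapsTo (Prod.snd : (Fin n → ℂ) × ℝ → ℝ) (ball n ×ˢ Set.Icc 0 T)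
      (Set.Icc 0 T) := fun p hp => hp.2
  refine ContinuousOn.mul ?_ (continuous_ofReal.comp_continuousOn
    (hω.comp continuous_snd.continuousOn hsnd))
  exact (continuousOn_kernelProd hg m).comp (f := fun p : (Fin n → ℂ) × ℝ => (p.1, w p.2))
    (continuous_fst.continuousOn.prodMk (hwc.comp continuous_snd.continuousOn hsnd))
    fun p hp => ⟨hp.1, hwb hp.2⟩

lemma Htilde.integrable_kernelProd_curve {m : ℕ} (hm : 1 ≤ m) {g : (Fin n → ℂ) → ℂ}
    (hg : Htilde G (m + 1) g) (hwc : ContinuousOn w (Set.Icc 0 T))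
    (hwb : Set.MapsTo w (Set.Icc 0 T) (ball n)) (hω : ContinuousOn ω (Set.Icc 0 T)) :
    Integrable (fun p : (Fin n → ℂ) × ℝ => kernelProd g m (w p.2) p.1 * (ω p.2 : ℂ))
      ((volume.restrict (ball n)).prod (volume.restrict (Set.Ioc 0 T))) := by
  obtain ⟨C, hC⟩ := hg.exists_norm_kernelProd_curve_le hm hwc hwb hω
  have hm' := measurableSet_ball (n := n).prod (measurableSet_Ioc (a := (0 : ℝ)) (b := T))
  rw [Measure.prod_restrict]
  refine IntegrableOn.of_bound ?_ (((continuousOn_kernelProd_curve hg.1.continuousOn m hwc hwb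
    hω).mono (Set.prod_mono_right Set.Ioc_subset_Icc_self)).aestronglyMeasurable hm') C
    ((ae_restrict_mem hm').mono fun p hp => hC _ hp.1 _ (Set.Ioc_subset_Icc_self hp.2))
  rw [Measure.prod_prod]
  exact ENNReal.mul_lt_top volume_ball_lt_top (by simp)

lemma Htilde.mul_star_integral_ThetaPt {m : ℕ} (hm : 1 ≤ m) {g : (Fin n → ℂ) → ℂ}
    (hg : Htilde G (m + 1) g) (hT : 0 ≤ T) (hwc : ContinuousOn w (Set.Icc 0 T))
    (hwb : Set.MapsTo w (Set.Icc 0 T) (ball n)) (hω : ContinuousOn ω (Set.Icc 0 T))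
    {z : Fin n → ℂ} (hz : z ∈ ball n)
    (hs : Summable fun A : G.Γ => ‖jac (A : Matrix (Fin (n + 1)) (Fin (n + 1)) ℂ) z‖ ^ 2) :
    g z * star (∫ x in (0 : ℝ)..T, ThetaPt G (m + 1) (w x) z * (ω x : ℂ)) *
        (((Kr z ^ m)⁻¹ : ℝ) : ℂ) =
      (cB n (m + 1) : ℂ) * ∑' A : G.Γ, ‖jac (A : Matrix (Fin (n + 1)) (Fin (n + 1)) ℂ) z‖ ^ 2 •
        ∫ x in Set.Ioc 0 T, kernelProd g m (w x) (act A z) * (ω x : ℂ) := by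
  have := G.countable
  obtain ⟨C, hC⟩ := hg.exists_norm_kernelProd_curve_le hm hwc hwb hω
  have hAz (A : G.Γ) : act A.1 z ∈ ball n := (G.isUnitaryForm A).act_mem hz
  have hint (A : G.Γ) : IntegrableOn (fun x => ‖jac A.1 z‖ ^ 2 •
      (kernelProd g m (w x) (act A z) * (ω x : ℂ))) (Set.Ioc 0 T) := by
    suffices IntegrableOn (fun x => kernelProd g m (w x) (act A.1 z) * (ω x : ℂ))
      (Set.Ioc 0 T) from
        Integrable.fun_smul (‖jac A.1 z‖ ^ 2) this
    refine IntegrableOn.of_bound measure_Ioc_lt_top ?_ C ?_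
    · have hc := (continuousOn_kernelProd_curve hg.1.continuousOn m hwc hwb hω).comp
        (f := fun x => (act A.1 z, x)) (s := Set.Icc 0 T) (by fun_prop) fun x hx => ⟨hAz A, hx⟩
      exact (hc.mono Set.Ioc_subset_Icc_self).aestronglyMeasurable measurableSet_Ioc
    · exact (ae_restrict_mem measurableSet_Ioc).mono fun x hx =>
        hC _ (hAz A) _ (Set.Ioc_subset_Icc_self hx)
  have hsum : Summable fun A : G.Γ => ∫ x in Set.Ioc 0 T, ‖‖jac A.1 z‖ ^ 2 •
      (kernelProd g m (w x) (act A z) * (ω x : ℂ))‖ := by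
    refine Summable.of_nonneg_of_le (fun A => integral_nonneg fun x => norm_nonneg _)
      (fun A => ?_) (hs.mul_right (C * T))
    calc _ ≤ ∫ x in Set.Ioc 0 T, ‖jac A.1 z‖ ^ 2 * C := by
          refine setIntegral_mono_on (hint A).norm (integrableOn_const measure_Ioc_lt_top.ne)
            measurableSet_Ioc fun x hx => ?_
          rw [norm_smul, norm_pow, norm_norm]
          gcongr
          exact hC _ (hAz A) _ (Set.Ioc_subset_Icc_self hx)
      _ = _ := by
          simp [hT]
          ring
  simp only [← integral_smul]
  rw [integral_tsum_of_summable_integral_norm hint hsum, intervalIntegral.integral_of_le hT,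
    Complex.star_def, ← integral_conj, ← integral_const_mul, ← integral_mul_const,
    ← integral_const_mul]
  refine integral_congr_ae (Eventually.of_forall fun x => ?_)
  simp only [← smul_mul_assoc, hg.smul_kernelProd_act _ hz]
  rw [tsum_mul_right, tsum_mul_right, tsum_mul_left, ← Complex.star_def, star_mul', ThetaPt,
    star_mul', tsum_star]
  simp only [Complex.star_def, Complex.conj_ofReal, map_natCast]
  ring

/-- The inner product with a relative Poincaré series along a weighted curve in the ball. -/
theorem Htilde.iprod_integral_ThetaPt {m : ℕ} (hm : 1 ≤ m) {g : (Fin n → ℂ) → ℂ}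
    (hg : Htilde G (m + 1) g) (hF : IsFundDom G F) (hT : 0 ≤ T)
    (hwc : ContinuousOn w (Set.Icc 0 T))
    (hwb : Set.MapsTo w (Set.Icc 0 T) (ball n)) (hω : ContinuousOn ω (Set.Icc 0 T)) :
    iprod F (m + 1) g (fun z => ∫ x in (0 : ℝ)..T, ThetaPt G (m + 1) (w x) z * (ω x : ℂ)) =
      ∫ x in (0 : ℝ)..T, g (w x) * (ω x : ℂ) := by
  have hprod := hg.integrable_kernelProd_curve hm hwc hwb hω
  have hΦ : IntegrableOn (fun z => ∫ x in Set.Ioc 0 T, kernelProd g m (w x) z * (ω x : ℂ))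
    (ball n) := hprod.integral_prod_left
  calc _ = ∫ z in F, (cB n (m + 1) : ℂ) * ∑' A : G.Γ, ‖jac A.1 z‖ ^ 2 •
        ∫ x in Set.Ioc 0 T, kernelProd g m (w x) (act A z) * (ω x : ℂ) := by
        rw [iprod]
        refine integral_congr_ae ?_
        filter_upwards [hF.ae_summable, ae_restrict_mem hF.2.1] with z hs hz
        rw [Kr_zpow_one_sub]
        exact hg.mul_star_integral_ThetaPt hm hT hwc hwb hω (hF.1 hz) hs
    _ = (cB n (m + 1) : ℂ) * ∫ z in ball n, ∫ x in Set.Ioc 0 T,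
        kernelProd g m (w x) z * (ω x : ℂ) := by
        rw [integral_const_mul, hF.integral_tsum hΦ]
    _ = (cB n (m + 1) : ℂ) * ∫ x in Set.Ioc 0 T, (∫ z in ball n, kernelProd g m (w x) z) *
        (ω x : ℂ) := by
        rw [integral_integral_swap hprod]
        simp only [integral_mul_const]
    _ = _ := by
        rw [intervalIntegral.integral_of_le hT, ← integral_const_mul]
        refine setIntegral_congr_fun measurableSet_Ioc fun x hx => ?_
        simp only [← mul_assoc]
        rw [hg.integral_kernelProd hm (hwb (Set.Ioc_subset_Icc_self hx))]

end Unfold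

end BallPaper

open BallPaper in
/-- for g ∈ H̃⁰_Γ(k),
(g, Θ_C^{(k)}) = ∫_C g(z) K(z,z)^{−k/2} ((A_γ⁻¹)*φ)(z), the integral over one period of
C̃ parametrized by z = A_γ(0,…,0,x), x ∈ [0,T]. -/
theorem iprod_ThetaC (n : ℕ) (hn : 0 < n) (G : BallPaper.DiscreteGroup n)
    (H : BallPaper.HypElt n G) (F : Set (Fin n → ℂ)) (hF : IsFundDom G F)
    (k : ℕ) (hk : 2 ≤ k) (g : (Fin n → ℂ) → ℂ) (hg : Htilde G k g) :
    iprod F k g (ThetaC hn H k) =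
      ∫ x in (0 : ℝ)..H.T, g (act H.A (curve n hn x)) *
        ((Kr (act H.A (curve n hn x)) ^ (-(k : ℝ) / 2) : ℝ) : ℂ) *
        ((Kr (curve n hn x) ^ (((n : ℝ) + 1))⁻¹ : ℝ) : ℂ) := by
  obtain ⟨m, rfl⟩ : ∃ m, k = m + 1 := ⟨k - 1, by omega⟩
  have h := hg.iprod_integral_ThetaPt (by omega) hF H.T_mem.1 (H.continuousOn_act_curve hn)
    (fun x hx => (H.act_curve_mem hn (H.sq_lt_one hx)).2)
    (H.continuousOn_weight hn (-((m + 1 : ℕ) : ℝ) / 2) (((n : ℝ) + 1))⁻¹)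
  simp only [ofReal_mul, ← mul_assoc] at h
  exact h
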